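/- Let $d \ge 2$, $0 < s$ with $s \ne \frac{1}{2}$, $\beta > -d$ with $\frac{d+\beta}{2s} \le \frac{d}{2}$, and $\frac{d+\beta}{2s} \le \theta \le \frac{d}{2}$. There is a constant $C = C(d, s, \beta, \theta)$ such that for every $t \ne 0$ and every Schwartz function $u_0$ on $\mathbb{R}^d$ whose Fourier transform is supported in $\{\xi : |\xi| \ge 1/2\}$: $\|(-\Delta)^{\beta/2} e^{-it(-\Delta)^s} u_0\|_{L^\infty(\mathbb{R}^d)} \le C\, |t|^{-\theta}\, \|u_0\|_{L^1(\mathbb{R}^d)}$. -/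

import Mathlib

open MeasureTheory Complex
open scoped ENNReal BigOperators RealInnerProductSpace

noncomputable section

abbrev Ed (d : ℕ) := EuclideanSpace ℝ (Fin d)

/-- Fourier transform with convention `(𝓕 f) ξ = ∫ e^{-i x·ξ} f x dx`. -/
def FT {d : ℕ} (f : Ed d → ℂ) (ξ : Ed d) : ℂ :=
  ∫ x : Ed d, Complex.exp (-Complex.I * ((⟪x, ξ⟫ : ℝ) : ℂ)) * f x

/-- Inverse Fourier transform `(2π)^{-d} ∫ e^{i x·ξ} g ξ dξ`. -/
def FTinv {d : ℕ} (g : Ed d → ℂ) (x : Ed d) : ℂ :=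
  (((2 * Real.pi) ^ (-(d : ℝ)) : ℝ) : ℂ) *
    ∫ ξ : Ed d, Complex.exp (Complex.I * ((⟪x, ξ⟫ : ℝ) : ℂ)) * g ξ

/-- Fractional Schrödinger propagator `e^{-it(-Δ)^s}`. -/
def fprop {d : ℕ} (s t : ℝ) (f : Ed d → ℂ) : Ed d → ℂ :=
  FTinv (fun ξ => Complex.exp (-Complex.I * (t : ℂ) * ((‖ξ‖ ^ (2 * s) : ℝ) : ℂ)) * FT f ξ)

/-- Fractional derivative `D^σ = (-Δ)^{σ/2}`, the Fourier multiplier `|ξ|^σ`. -/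
def fracD {d : ℕ} (σ : ℝ) (f : Ed d → ℂ) : Ed d → ℂ :=
  FTinv (fun ξ => ((‖ξ‖ ^ σ : ℝ) : ℂ) * FT f ξ)

/-- `(-Δ)^{β/2} e^{-it(-Δ)^s}`. -/
def fracDProp {d : ℕ} (β s t : ℝ) (f : Ed d → ℂ) : Ed d → ℂ :=
  FTinv (fun ξ => ((‖ξ‖ ^ β : ℝ) : ℂ) *
    Complex.exp (-Complex.I * (t : ℂ) * ((‖ξ‖ ^ (2 * s) : ℝ) : ℂ)) * FT f ξ)

/-- Resolvent `(-Δ + λ)⁻¹`. -/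
def resolv {d : ℕ} (lam : ℝ) (f : Ed d → ℂ) : Ed d → ℂ :=
  FTinv (fun ξ => FT f ξ / ((‖ξ‖ ^ 2 + lam : ℝ) : ℂ))

/-- Resolvent-regularization `u_λ = √(sin(πs)/π) (-Δ+λ)⁻¹ u`. -/
def reg {d : ℕ} (s lam : ℝ) (f : Ed d → ℂ) : Ed d → ℂ :=
  fun x => ((Real.sqrt (Real.sin (Real.pi * s) / Real.pi) : ℝ) : ℂ) * resolv lam f x

/-- A function is radial if its value depends only on `|x|`. -/
def IsRadial {d : ℕ} (f : Ed d → ℂ) : Prop :=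
  ∀ x y : Ed d, ‖x‖ = ‖y‖ → f x = f y

/-- Homogeneous Sobolev norm `‖f‖_{Ḣ^s} = (2π)^{-d/2} ‖ |ξ|^s 𝓕f ‖_{L²}`. -/
def HdotNorm {d : ℕ} (s : ℝ) (f : Ed d → ℂ) : ℝ :=
  (2 * Real.pi) ^ (-(d : ℝ) / 2) *
    (eLpNorm (fun ξ : Ed d => ((‖ξ‖ ^ s : ℝ) : ℂ) * FT f ξ) 2 volume).toReal

/-- Inhomogeneous Sobolev norm `‖f‖_{H^s}² = ‖f‖_{L²}² + ‖f‖_{Ḣ^s}²`. -/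
def HNorm {d : ℕ} (s : ℝ) (f : Ed d → ℂ) : ℝ :=
  Real.sqrt ((eLpNorm f 2 volume).toReal ^ 2 + HdotNorm s f ^ 2)

/-- Mixed space-time norm `L^q_t L^r_x (ℝ × ℝ^d)`. -/
def mixedNorm {d : ℕ} (q r : ℝ≥0∞) (F : ℝ → Ed d → ℂ) : ℝ≥0∞ :=
  eLpNorm (fun t => (eLpNorm (F t) r volume).toReal) q volume

/-- Partial derivative `∂_j` of a complex-valued function. -/
def pd {d : ℕ} (j : Fin d) (f : Ed d → ℂ) (x : Ed d) : ℂ :=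
  fderiv ℝ f x (EuclideanSpace.single j 1)

/-- Partial derivative `∂_j` of a real-valued function. -/
def pdR {d : ℕ} (j : Fin d) (f : Ed d → ℝ) (x : Ed d) : ℝ :=
  fderiv ℝ f x (EuclideanSpace.single j 1)

/-- Laplacian of a real-valued function. -/
def lapR {d : ℕ} (f : Ed d → ℝ) : Ed d → ℝ :=
  fun x => ∑ j : Fin d, pdR j (pdR j f) x

/-- Rescaling `χ_R(x) = χ(x/R)`. -/
def chiR {d : ℕ} (χ : Ed d → ℝ) (R : ℝ) : Ed d → ℝ :=
  fun x => χ (R⁻¹ • x)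


/-- Squared `H^{1/2}` norm `(2π)^{-d} ∫ (1+|ξ|²)^{1/2} |𝓕u(ξ)|² dξ`. -/
def H12sq {d : ℕ} (f : Ed d → ℂ) : ℝ :=
  (2 * Real.pi) ^ (-(d : ℝ)) * ∫ ξ : Ed d, (1 + ‖ξ‖ ^ 2) ^ ((1 : ℝ)/2) * ‖FT f ξ‖ ^ 2

section NonstationaryPhase

set_option linter.unusedSectionVars false

open scoped ContDiff Topology

variable {P E ι : Type*} [NormedAddCommGroup P] [NormedSpace ℝ P]
  [NormedAddCommGroup E] [NormedSpace ℝ E] [Fintype ι]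

/-- A smooth cutoff equal to `1` on a compact set, with compact support in a given open set. -/
lemma exists_contDiff_cutoff [FiniteDimensional ℝ E] {Z W : Set E} (hZ : IsCompact Z)
    (hW : IsOpen W) (hZW : Z ⊆ W) :
    ∃ κ : E → ℝ, ContDiff ℝ ∞ κ ∧ HasCompactSupport κ ∧ tsupport κ ⊆ W ∧ ∀ z ∈ Z, κ z = 1 := by
  obtain ⟨L, hL, hZL, hLW⟩ := exists_compact_between hZ hW hZW
  obtain ⟨κ, h1, -, h3, h4⟩ := exists_contMDiff_support_eq_eq_one_iff (n := ⊤)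
    (modelWithCornersSelf ℝ E) (isOpen_interior (s := L)) hZ.isClosed hZL
  have hsub : tsupport κ ⊆ L := by
    rw [tsupport, h3]
    exact closure_minimal interior_subset hL.isClosed
  exact ⟨κ, h1.contDiff, HasCompactSupport.of_support_subset_isCompact hL
    (subset_closure.trans hsub), hsub.trans hLW, fun z hz => (h4 z).1 hz⟩

/-- A function that is smooth on its topological support is smooth. -/
lemma contDiff_of_contDiffAt_tsupport {F : Type*} [NormedAddCommGroup F] [NormedSpace ℝ F]
    {f : E → F} (h : ∀ x ∈ tsupport f, ContDiffAt ℝ ∞ f x) : ContDiff ℝ ∞ f := by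
  rw [contDiff_iff_contDiffAt]
  intro x
  by_cases hx : x ∈ tsupport f
  · exact h x hx
  · exact contDiffAt_const.congr_of_eventuallyEq (notMem_tsupport_iff_eventuallyEq.1 hx)

lemma contDiff_fderiv_apply {F : Type*} [NormedAddCommGroup F] [NormedSpace ℝ F]
    {f : E → F} (h : ContDiff ℝ ∞ f) (v : E) : ContDiff ℝ ∞ (fun x => fderiv ℝ f x v) :=
  (h.fderiv_right (m := ∞) le_rfl).clm_apply contDiff_const

/-- Squared length of the gradient of the phase in the second variable. -/
def gradSq (b : ι → E) (Φ : P × E → ℝ) (q : P × E) : ℝ :=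
  ∑ j, fderiv ℝ Φ q (0, b j) ^ 2

/-- The `j`-th component of the amplitude after division by the gradient of the phase. -/
def ampDiv (b : ι → E) (Φ : P × E → ℝ) (a : P × E → ℂ) (j : ι) (q : P × E) : ℂ :=
  ((fderiv ℝ Φ q (0, b j) / gradSq b Φ q : ℝ) : ℂ) * a q

/-- The amplitude produced by one integration by parts. -/
def ampNext (b : ι → E) (Φ : P × E → ℝ) (a : P × E → ℂ) (q : P × E) : ℂ :=
  ∑ j, fderiv ℝ (ampDiv b Φ a j) q (0, b j)

variable {b : ι → E} {Φ : P × E → ℝ} {a : P × E → ℂ}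

lemma contDiff_gradSq (hΦ : ContDiff ℝ ∞ Φ) : ContDiff ℝ ∞ (gradSq b Φ) :=
  ContDiff.sum fun _ _ => (contDiff_fderiv_apply hΦ _).pow 2

lemma tsupport_ampDiv_subset (j : ι) : tsupport (ampDiv b Φ a j) ⊆ tsupport a :=
  tsupport_mul_subset_right

lemma contDiff_ampDiv (hΦ : ContDiff ℝ ∞ Φ) (ha : ContDiff ℝ ∞ a)
    (hg : ∀ q ∈ tsupport a, gradSq b Φ q ≠ 0) (j : ι) : ContDiff ℝ ∞ (ampDiv b Φ a j) := by
  refine contDiff_of_contDiffAt_tsupport fun q hq => ?_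
  have h1 : ContDiffAt ℝ ∞ (fun q => fderiv ℝ Φ q (0, b j) / gradSq b Φ q) q :=
    (contDiff_fderiv_apply hΦ _).contDiffAt.div (contDiff_gradSq hΦ).contDiffAt
      (hg q (tsupport_ampDiv_subset j hq))
  exact (ofRealCLM.contDiff.contDiffAt.comp q h1).mul ha.contDiffAt

lemma tsupport_ampNext_subset : tsupport (ampNext b Φ a) ⊆ tsupport a := by
  refine closure_minimal (fun q hq => ?_) (isClosed_tsupport a)
  by_contra hq'
  refine hq (Finset.sum_eq_zero fun j _ => ?_)
  have : q ∉ tsupport (fderiv ℝ (ampDiv b Φ a j)) := fun h =>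
    hq' (tsupport_ampDiv_subset j (tsupport_fderiv_subset ℝ h))
  rw [image_eq_zero_of_notMem_tsupport this]
  rfl

lemma contDiff_ampNext (hΦ : ContDiff ℝ ∞ Φ) (ha : ContDiff ℝ ∞ a)
    (hg : ∀ q ∈ tsupport a, gradSq b Φ q ≠ 0) : ContDiff ℝ ∞ (ampNext b Φ a) :=
  ContDiff.sum fun j _ => contDiff_fderiv_apply (contDiff_ampDiv hΦ ha hg j) _

lemma sum_fderiv_mul_ampDiv (hg : ∀ q ∈ tsupport a, gradSq b Φ q ≠ 0) (q : P × E) :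
    ∑ j, ((fderiv ℝ Φ q (0, b j) : ℝ) : ℂ) * ampDiv b Φ a j q = a q := by
  by_cases hq : q ∈ tsupport a
  · simp only [ampDiv, ← mul_assoc, ← Finset.sum_mul, ← ofReal_mul, ← ofReal_sum]
    have : ∑ j, fderiv ℝ Φ q (0, b j) * (fderiv ℝ Φ q (0, b j) / gradSq b Φ q) = 1 := by
      simp only [← mul_div_assoc, ← Finset.sum_div, ← sq]
      exact div_self (hg q hq)
    rw [this]; simp
  · simp [ampDiv, image_eq_zero_of_notMem_tsupport hq]

lemma fderiv_slice {F : Type*} [NormedAddCommGroup F] [NormedSpace ℝ F] {f : P × E → F}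
    (hf : ContDiff ℝ ∞ f) (p : P) (x v : E) :
    fderiv ℝ (fun x => f (p, x)) x v = fderiv ℝ f (p, x) (0, v) := by
  have h1 : HasFDerivAt (fun x : E => (p, x)) (ContinuousLinearMap.inr ℝ P E) x :=
    hasFDerivAt_prodMk_right p x
  have h2 := ((hf.differentiable (by simp)) (p, x)).hasFDerivAt.comp x h1
  rw [show (fun x => f (p, x)) = f ∘ fun x => (p, x) from rfl, h2.fderiv]
  simp

lemma hasCompactSupport_slice {F : Type*} [Zero F] {f : P × E → F}
    (hf : HasCompactSupport f) (p : P) : HasCompactSupport (fun x => f (p, x)) := by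
  refine HasCompactSupport.of_support_subset_isCompact (hf.isCompact.image continuous_snd) ?_
  exact fun x hx => ⟨(p, x), subset_tsupport f hx, rfl⟩

variable [FiniteDimensional ℝ E] [MeasurableSpace E] [BorelSpace E] (μ : Measure E)
  [μ.IsAddHaarMeasure]

lemma integral_exp_phase_eq (hΦ : ContDiff ℝ ∞ Φ) (ha : ContDiff ℝ ∞ a)
    (hc : HasCompactSupport a) (hg : ∀ q ∈ tsupport a, gradSq b Φ q ≠ 0) (p : P) (l : ℝ) :
    I * l * ∫ x, exp (I * l * Φ (p, x)) * a (p, x) ∂μ =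
      -∫ x, exp (I * l * Φ (p, x)) * ampNext b Φ a (p, x) ∂μ := by
  have hpx : ContDiff ℝ ∞ (fun x : E => (p, x)) := contDiff_const.prodMk contDiff_id
  have hΦp : ContDiff ℝ ∞ (fun x : E => Φ (p, x)) := hΦ.comp hpx
  have hexp : ContDiff ℝ ∞ (fun x : E => exp (I * l * Φ (p, x))) :=
    (contDiff_const.mul (ofRealCLM.contDiff.comp hΦp)).cexp
  have hB (j : ι) : ContDiff ℝ ∞ (fun x : E => ampDiv b Φ a j (p, x)) :=
    (contDiff_ampDiv hΦ ha hg j).comp hpx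
  have hBc (j : ι) : HasCompactSupport (fun x : E => ampDiv b Φ a j (p, x)) :=
    hasCompactSupport_slice (hc.of_isClosed_subset (isClosed_tsupport _)
      (tsupport_ampDiv_subset j)) p
  have hBd (j : ι) : HasCompactSupport
      (fun x : E => fderiv ℝ (fun x => ampDiv b Φ a j (p, x)) x (b j)) :=
    (hBc j).fderiv_apply ℝ (b j)
  have hder (x v : E) : fderiv ℝ (fun x : E => exp (I * l * Φ (p, x))) x v =
      I * l * (exp (I * l * Φ (p, x)) * (fderiv ℝ Φ (p, x) (0, v) : ℝ)) := by
    have h1 : HasFDerivAt (fun x : E => Φ (p, x)) (fderiv ℝ (fun x : E => Φ (p, x)) x) x :=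
      ((hΦp.differentiable (by simp)) x).hasFDerivAt
    have h2 := ((ofRealCLM.hasFDerivAt.comp x h1).const_mul (I * (l : ℂ))).cexp
    have h3 := h2.fderiv
    simp only [Function.comp_def, ofRealCLM_apply] at h3
    rw [h3]
    simp only [smul_apply, ContinuousLinearMap.comp_apply, ofRealCLM_apply,
      smul_eq_mul, fderiv_slice hΦ]
    ring
  have hcd (j : ι) : Continuous (fun x : E => fderiv ℝ (fun x => ampDiv b Φ a j (p, x)) x (b j)) :=
    (contDiff_fderiv_apply (hB j) _).continuous
  have hparts (j : ι) : ∫ x, exp (I * l * Φ (p, x)) * fderiv ℝ (ampDiv b Φ a j) (p, x) (0, b j) ∂μ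
      = -∫ x, I * l * (exp (I * l * Φ (p, x)) *
          ((fderiv ℝ Φ (p, x) (0, b j) : ℝ) * ampDiv b Φ a j (p, x))) ∂μ := by
    have := integral_mul_fderiv_eq_neg_fderiv_mul_of_integrable (μ := μ)
      (f := fun x : E => exp (I * l * Φ (p, x))) (g := fun x => ampDiv b Φ a j (p, x)) (v := b j)
      (((contDiff_fderiv_apply hexp _).continuous.mul
        (hB j).continuous).integrable_of_hasCompactSupport (hBc j).mul_left)
      ((hexp.continuous.mul (hcd j)).integrable_of_hasCompactSupport (hBd j).mul_left)
      ((hexp.continuous.mul (hB j).continuous).integrable_of_hasCompactSupport (hBc j).mul_left)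
      (fun x _ => hexp.differentiable (by simp) x)
      (fun x _ => (hB j).differentiable (by simp) x)
    simp only [fderiv_slice (contDiff_ampDiv hΦ ha hg j), hder] at this
    rw [this]
    congr 2
    ext x; ring
  have hint1 (j : ι) : Integrable (fun x => exp (I * l * Φ (p, x)) *
      fderiv ℝ (ampDiv b Φ a j) (p, x) (0, b j)) μ := by
    have := (hexp.continuous.mul (hcd j)).integrable_of_hasCompactSupport (μ := μ) (hBd j).mul_left
    simp only [fderiv_slice (contDiff_ampDiv hΦ ha hg j)] at this
    exact this
  have hint2 (j : ι) : Integrable (fun x => I * l * (exp (I * l * Φ (p, x)) *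
          ((fderiv ℝ Φ (p, x) (0, b j) : ℝ) * ampDiv b Φ a j (p, x)))) μ := by
    have hcΦ : Continuous (fun x => ((fderiv ℝ Φ (p, x) (0, b j) : ℝ) : ℂ)) :=
      continuous_ofReal.comp ((contDiff_fderiv_apply hΦ _).continuous.comp hpx.continuous)
    exact ((hexp.continuous.mul (hcΦ.mul (hB j).continuous)).integrable_of_hasCompactSupport
      (hBc j).mul_left.mul_left).const_mul _
  calc I * l * ∫ x, exp (I * l * Φ (p, x)) * a (p, x) ∂μ
      = ∫ x, ∑ j, I * l * (exp (I * l * Φ (p, x)) *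
          ((fderiv ℝ Φ (p, x) (0, b j) : ℝ) * ampDiv b Φ a j (p, x))) ∂μ := by
        rw [← integral_const_mul]
        congr 1; ext x
        rw [← Finset.mul_sum, ← Finset.mul_sum, sum_fderiv_mul_ampDiv hg]
    _ = -∫ x, ∑ j, exp (I * l * Φ (p, x)) * fderiv ℝ (ampDiv b Φ a j) (p, x) (0, b j) ∂μ := by
        rw [integral_finsetSum _ fun j _ => hint1 j, integral_finsetSum _ fun j _ => hint2 j,
          ← Finset.sum_neg_distrib]
        refine Finset.sum_congr rfl fun j _ => ?_
        rw [hparts, neg_neg]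
    _ = _ := by
        simp only [ampNext, Finset.mul_sum]

lemma norm_exp_phase (l y : ℝ) : ‖exp (I * l * y)‖ = 1 := by
  rw [show I * l * y = ((l * y : ℝ) : ℂ) * I by push_cast; ring]
  exact norm_exp_ofReal_mul_I _

lemma exists_norm_integral_exp_phase_le (ha : Continuous a) (hc : HasCompactSupport a) :
    ∃ C : ℝ, 0 ≤ C ∧ ∀ (p : P) (l : ℝ),
      ‖∫ x, exp (I * l * Φ (p, x)) * a (p, x) ∂μ‖ ≤ C := by
  obtain ⟨B, hB⟩ := hc.exists_bound_of_continuous ha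
  set K : Set E := Prod.snd '' tsupport a
  have hK : IsCompact K := hc.isCompact.image continuous_snd
  refine ⟨|B| * μ.real K, by positivity, fun p l => ?_⟩
  have h0 : ∀ x, x ∉ K → exp (I * l * Φ (p, x)) * a (p, x) = 0 := fun x hx => by
    have : a (p, x) = 0 := by
      by_contra h
      exact hx ⟨(p, x), subset_tsupport a h, rfl⟩
    simp [this]
  rw [← setIntegral_eq_integral_of_forall_compl_eq_zero h0]
  refine norm_setIntegral_le_of_norm_le_const hK.measure_lt_top fun x _ => ?_
  rw [norm_mul, norm_exp_phase, one_mul]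
  exact (hB _).trans (le_abs_self B)

/-- Nonstationary phase with a smooth parameter, for compactly supported amplitudes. -/
lemma nonstationary_phase_aux (hΦ : ContDiff ℝ ∞ Φ) (M : ℕ) (a : P × E → ℂ)
    (ha : ContDiff ℝ ∞ a) (hc : HasCompactSupport a)
    (hg : ∀ q ∈ tsupport a, gradSq b Φ q ≠ 0) :
    ∃ C : ℝ, 0 ≤ C ∧ ∀ (p : P) (l : ℝ),
      |l| ^ M * ‖∫ x, exp (I * l * Φ (p, x)) * a (p, x) ∂μ‖ ≤ C := by
  induction M generalizing a with
  | zero => simpa using exists_norm_integral_exp_phase_le μ ha.continuous hc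
  | succ M ih =>
    obtain ⟨C, hC, h⟩ := ih (ampNext b Φ a) (contDiff_ampNext hΦ ha hg)
      (hc.of_isClosed_subset (isClosed_tsupport _) tsupport_ampNext_subset)
      (fun q hq => hg q (tsupport_ampNext_subset hq))
    refine ⟨C, hC, fun p l => ?_⟩
    have := congrArg norm (integral_exp_phase_eq μ hΦ ha hc hg p l)
    rw [norm_mul, norm_mul, norm_I, one_mul, norm_neg, norm_real, Real.norm_eq_abs] at this
    rw [pow_succ, mul_assoc, this]
    exact h p l

/-- Nonstationary phase with a parameter: if the phase has nonvanishing gradient in the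
second variable on a compact set `Z`, then the oscillatory integrals whose amplitude lives in `Z` decay
rapidly, uniformly in the parameter. -/
lemma nonstationary_phase [FiniteDimensional ℝ P] (hΦ : ContDiff ℝ ∞ Φ) (ha : ContDiff ℝ ∞ a)
    {Z : Set (P × E)} (hZ : IsCompact Z) (hg : ∀ q ∈ Z, gradSq b Φ q ≠ 0) (M : ℕ) :
    ∃ C : ℝ, 0 ≤ C ∧ ∀ p : P, (∀ x, a (p, x) ≠ 0 → (p, x) ∈ Z) → ∀ l : ℝ,
      ‖∫ x, exp (I * l * Φ (p, x)) * a (p, x) ∂μ‖ ≤ C / (1 + |l|) ^ M := by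
  obtain ⟨κ, hκ, hκc, hκs, hκ1⟩ := exists_contDiff_cutoff hZ
    ((contDiff_gradSq (b := b) hΦ).continuous.isOpen_preimage _ isOpen_compl_singleton) hg
  set a' : P × E → ℂ := fun q => (κ q : ℂ) * a q
  have hsupp : tsupport a' ⊆ tsupport κ := by
    refine closure_mono fun q hq hκq => hq ?_
    simp [a', hκq]
  have ha' : ContDiff ℝ ∞ a' := (ofRealCLM.contDiff.comp hκ).mul ha
  have hc' : HasCompactSupport a' := hκc.of_isClosed_subset (isClosed_tsupport _) hsupp
  have hg' : ∀ q ∈ tsupport a', gradSq b Φ q ≠ 0 := fun q hq => hκs (hsupp hq)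
  obtain ⟨C₀, hC₀, h₀⟩ := nonstationary_phase_aux μ hΦ 0 a' ha' hc' hg'
  obtain ⟨C₁, hC₁, h₁⟩ := nonstationary_phase_aux μ hΦ M a' ha' hc' hg'
  refine ⟨2 ^ M * (C₀ + C₁), by positivity, fun p hp l => ?_⟩
  have heq : ∀ x, a (p, x) = a' (p, x) := fun x => by
    by_cases hx : a (p, x) = 0
    · simp [a', hx]
    · simp [a', hκ1 _ (hp x hx)]
  simp only [heq]
  rw [le_div_iff₀ (by positivity)]
  set J := ‖∫ x, exp (I * l * Φ (p, x)) * a' (p, x) ∂μ‖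
  have hJ : 0 ≤ J := norm_nonneg _
  have e0 : J ≤ C₀ := by simpa using h₀ p l
  have e1 : |l| ^ M * J ≤ C₁ := h₁ p l
  have e2 : (1 + |l|) ^ M ≤ 2 ^ M * (1 + |l| ^ M) := by
    have h3 : (1 + |l|) ^ M ≤ (2 * max 1 |l|) ^ M := by
      gcongr
      linarith [le_max_left 1 |l|, le_max_right 1 |l|]
    rw [mul_pow] at h3
    refine h3.trans ?_
    gcongr
    rcases max_choice 1 |l| with h | h <;> rw [h] <;> simp
  calc J * (1 + |l|) ^ M ≤ J * (2 ^ M * (1 + |l| ^ M)) := by gcongr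
    _ = 2 ^ M * (J + |l| ^ M * J) := by ring
    _ ≤ _ := by gcongr

end NonstationaryPhase

section Amplitudes

open scoped ContDiff Topology

variable {d : ℕ}

/-- A radial bump function equal to `1` on the unit ball and supported in the ball of radius `2`. -/
def unitBump (d : ℕ) : ContDiffBump (0 : Ed d) := ⟨1, 2, one_pos, one_lt_two⟩

lemma unitBump_eq_one {ξ : Ed d} (h : ‖ξ‖ ≤ 1) : unitBump d ξ = 1 :=
  (unitBump d).one_of_mem_closedBall (by simpa [unitBump] using h)

lemma unitBump_eq_zero {ξ : Ed d} (h : 2 ≤ ‖ξ‖) : unitBump d ξ = 0 :=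
  (unitBump d).zero_of_le_dist (by simpa [unitBump] using h)

lemma contDiff_unitBump_smul (c : ℝ) : ContDiff ℝ ∞ (fun ξ : Ed d => unitBump d (c • ξ)) :=
  (unitBump d).contDiff.comp (contDiff_const_smul c)

/-- A smooth cutoff to the annulus `1/2 ≤ ‖ξ‖ ≤ 2`. -/
def annulusBump (d : ℕ) (ξ : Ed d) : ℝ := unitBump d ξ - unitBump d ((2 : ℝ) • ξ)

lemma annulusBump_ne_zero {ξ : Ed d} (h : annulusBump d ξ ≠ 0) : 1 / 2 ≤ ‖ξ‖ ∧ ‖ξ‖ ≤ 2 := by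
  refine ⟨?_, ?_⟩
  · by_contra! hlt
    refine h ?_
    rw [annulusBump, unitBump_eq_one (by linarith), unitBump_eq_one, sub_self]
    rw [norm_smul, Real.norm_ofNat]; linarith
  · by_contra! hlt
    refine h ?_
    rw [annulusBump, unitBump_eq_zero hlt.le, unitBump_eq_zero, sub_self]
    rw [norm_smul, Real.norm_ofNat]; linarith

lemma contDiff_annulusBump : ContDiff ℝ ∞ (annulusBump d) :=
  (unitBump d).contDiff.sub (contDiff_unitBump_smul 2)

/-- A smooth function vanishing near the origin stays smooth after multiplication by a power of
the norm. -/
lemma contDiff_norm_rpow_mul {f : Ed d → ℝ} (hf : ContDiff ℝ ∞ f) (h0 : f =ᶠ[𝓝 0] 0) (σ : ℝ) :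
    ContDiff ℝ ∞ (fun ξ => ‖ξ‖ ^ σ * f ξ) := by
  rw [contDiff_iff_contDiffAt]
  intro ξ
  by_cases hξ : ξ = 0
  · subst hξ
    refine (contDiffAt_const (c := (0 : ℝ))).congr_of_eventuallyEq ?_
    filter_upwards [h0] with y hy
    simp [hy]
  · exact ((contDiffAt_norm ℝ hξ).rpow_const_of_ne (norm_ne_zero_iff.2 hξ)).mul hf.contDiffAt

/-- The symbol `‖ξ‖ ^ β` localized to the unit annulus. -/
def annulusAmp (d : ℕ) (β : ℝ) (ξ : Ed d) : ℝ := ‖ξ‖ ^ β * annulusBump d ξ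

lemma annulusAmp_ne_zero {β : ℝ} {ξ : Ed d} (h : annulusAmp d β ξ ≠ 0) :
    1 / 2 ≤ ‖ξ‖ ∧ ‖ξ‖ ≤ 2 :=
  annulusBump_ne_zero (right_ne_zero_of_mul h)

lemma contDiff_annulusAmp (β : ℝ) : ContDiff ℝ ∞ (annulusAmp d β) := by
  refine contDiff_norm_rpow_mul contDiff_annulusBump ?_ β
  filter_upwards [Metric.ball_mem_nhds (0 : Ed d) (show (0 : ℝ) < 1 / 2 by norm_num)] with ξ hξ
  by_contra h
  rw [mem_ball_zero_iff] at hξ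
  linarith [(annulusBump_ne_zero h).1]

/-- The closed unit annulus `1/2 ≤ ‖ξ‖ ≤ 2`. -/
def unitAnnulus (d : ℕ) : Set (Ed d) := {ξ | 1 / 2 ≤ ‖ξ‖ ∧ ‖ξ‖ ≤ 2}

lemma isCompact_unitAnnulus : IsCompact (unitAnnulus d) := by
  refine (isCompact_closedBall (0 : Ed d) 2).of_isClosed_subset ?_ fun ξ hξ => by simpa using hξ.2
  exact (isClosed_le continuous_const continuous_norm).inter
    (isClosed_le continuous_norm continuous_const)

lemma hasCompactSupport_annulusAmp (β : ℝ) : HasCompactSupport (annulusAmp d β) :=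
  HasCompactSupport.of_support_subset_isCompact isCompact_unitAnnulus
    fun _ h => annulusAmp_ne_zero h

/-- A globally smooth function equal to `‖ξ‖ ^ (2 * s)` for `1/4 ≤ ‖ξ‖`. -/
def smoothPow (d : ℕ) (s : ℝ) (ξ : Ed d) : ℝ := ‖ξ‖ ^ (2 * s) * (1 - unitBump d ((8 : ℝ) • ξ))

lemma smoothPow_eq (s : ℝ) {ξ : Ed d} (h : 1 / 4 ≤ ‖ξ‖) : smoothPow d s ξ = ‖ξ‖ ^ (2 * s) := by
  rw [smoothPow, unitBump_eq_zero, sub_zero, mul_one]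
  rw [norm_smul, Real.norm_ofNat]; linarith

lemma contDiff_smoothPow (s : ℝ) : ContDiff ℝ ∞ (smoothPow d s) := by
  refine contDiff_norm_rpow_mul (contDiff_const.sub (contDiff_unitBump_smul 8)) ?_ _
  filter_upwards [Metric.ball_mem_nhds (0 : Ed d) (show (0 : ℝ) < 1 / 8 by norm_num)] with ξ hξ
  rw [mem_ball_zero_iff] at hξ
  rw [unitBump_eq_one, sub_self, Pi.zero_apply]
  rw [norm_smul, Real.norm_ofNat]; linarith

lemma hasFDerivAt_norm_sq_rpow (s : ℝ) {ξ : Ed d} (hξ : ξ ≠ 0) :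
    HasFDerivAt (fun ξ : Ed d => (‖ξ‖ ^ 2) ^ s)
      ((s * (‖ξ‖ ^ 2) ^ (s - 1)) • (2 : ℝ) • innerSL ℝ ξ) ξ := by
  have h : HasFDerivAt (fun ξ : Ed d => ‖ξ‖ ^ 2) ((2 : ℝ) • innerSL ℝ ξ) ξ := by
    simpa only [two_smul] using (hasStrictFDerivAt_norm_sq ξ).hasFDerivAt
  have h2 : HasDerivAt (fun y : ℝ => y ^ s) (s * (‖ξ‖ ^ 2) ^ (s - 1)) (‖ξ‖ ^ 2) :=
    Real.hasDerivAt_rpow_const (Or.inl (by simpa using hξ))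
  exact h2.comp_hasFDerivAt ξ h

lemma fderiv_smoothPow (s : ℝ) {ξ : Ed d} (h : 1 / 4 < ‖ξ‖) (v : Ed d) :
    fderiv ℝ (smoothPow d s) ξ v = 2 * s * (‖ξ‖ ^ 2) ^ (s - 1) * ⟪ξ, v⟫ := by
  have hξ : ξ ≠ 0 := norm_pos_iff.1 (by linarith)
  have heq : smoothPow d s =ᶠ[𝓝 ξ] fun ξ : Ed d => (‖ξ‖ ^ 2) ^ s := by
    filter_upwards [continuous_norm.continuousAt.eventually_mem (Ioi_mem_nhds h)] with y hy
    rw [smoothPow_eq s (le_of_lt hy), Real.rpow_mul (norm_nonneg _), Real.rpow_two]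
  rw [heq.fderiv_eq, (hasFDerivAt_norm_sq_rpow s hξ).fderiv]
  simp; ring

lemma fderiv_fderiv_smoothPow (s : ℝ) {ξ : Ed d} (h : 1 / 4 < ‖ξ‖) (w v : Ed d) :
    fderiv ℝ (fun y => fderiv ℝ (smoothPow d s) y w) ξ v =
      2 * s * ((s - 1) * (‖ξ‖ ^ 2) ^ (s - 2) * 2 * ⟪ξ, v⟫ * ⟪ξ, w⟫
        + (‖ξ‖ ^ 2) ^ (s - 1) * ⟪v, w⟫) := by
  have hξ : ξ ≠ 0 := norm_pos_iff.1 (by linarith)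
  have heq : (fun y => fderiv ℝ (smoothPow d s) y w) =ᶠ[𝓝 ξ]
      fun y => 2 * s * ((‖y‖ ^ 2) ^ (s - 1) * ⟪y, w⟫) := by
    filter_upwards [continuous_norm.continuousAt.eventually_mem (Ioi_mem_nhds h)] with y hy
    rw [fderiv_smoothPow s hy, mul_assoc]
  have h1 := hasFDerivAt_norm_sq_rpow (s - 1) hξ
  have h2 : HasFDerivAt (fun y : Ed d => ⟪y, w⟫) (innerSL ℝ w) ξ := by
    simp_rw [real_inner_comm w]
    exact (innerSL ℝ w).hasFDerivAt
  have h3 := ((h1.mul h2).const_mul (2 * s)).fderiv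
  simp only [Pi.mul_apply] at h3
  rw [heq.fderiv_eq, h3, show s - 2 = s - 1 - 1 by ring]
  simp [real_inner_comm]
  ring

/-- The Hessian of `‖ξ‖ ^ (2 * s)` is nondegenerate when `s ≠ 1/2`. -/
lemma exists_fderiv_fderiv_smoothPow_ne_zero {s : ℝ} (hs : 0 < s) (hs' : s ≠ 1 / 2) {ξ : Ed d}
    (h : 1 / 4 < ‖ξ‖) {w : Ed d} (hw : w ≠ 0) :
    ∃ v, fderiv ℝ (fun y => fderiv ℝ (smoothPow d s) y w) ξ v ≠ 0 := by
  by_contra! H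
  simp only [fderiv_fderiv_smoothPow s h] at H
  have hpos : 0 < ‖ξ‖ ^ 2 := by have : 0 < ‖ξ‖ := by linarith
                                positivity
  have hp := Real.rpow_pos_of_pos hpos (s - 1)
  have hsplit : (‖ξ‖ ^ 2) ^ (s - 1) = (‖ξ‖ ^ 2) ^ (s - 2) * ‖ξ‖ ^ 2 := by
    rw [← Real.rpow_add_one hpos.ne']; congr 1; ring
  have h1 : ⟪ξ, w⟫ = 0 := by
    have := H ξ
    rw [real_inner_self_eq_norm_sq] at this
    have h3 : 2 * s * ((2 * s - 1) * (‖ξ‖ ^ 2) ^ (s - 1)) * ⟪ξ, w⟫ = 0 := by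
      rw [← this, hsplit]; ring
    refine (mul_eq_zero.1 h3).resolve_left ?_
    have : 2 * s - 1 ≠ 0 := fun h => hs' (by linarith)
    positivity
  have h2 := H w
  rw [h1, real_inner_self_eq_norm_sq] at h2
  have h4 : 2 * s * (‖ξ‖ ^ 2) ^ (s - 1) * ‖w‖ ^ 2 = 0 := by rw [← h2]; ring
  have : 0 < ‖w‖ := norm_pos_iff.2 hw
  have : 0 < 2 * s * (‖ξ‖ ^ 2) ^ (s - 1) * ‖w‖ ^ 2 := by positivity
  linarith

lemma norm_grad_smoothPow (s : ℝ) (hs : 0 < s) {ξ : Ed d} (h : 0 < ‖ξ‖) :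
    ‖(2 * s * (‖ξ‖ ^ 2) ^ (s - 1)) • ξ‖ = 2 * s * ‖ξ‖ ^ (2 * s - 1) := by
  rw [norm_smul, Real.norm_of_nonneg (by positivity), ← Real.rpow_two,
    ← Real.rpow_mul h.le, mul_assoc, ← Real.rpow_add_one h.ne']
  congr 2; ring

/-- The gradient of `‖ξ‖ ^ (2 * s)` is injective when `s ≠ 1/2`. -/
lemma eq_of_fderiv_smoothPow_eq {s : ℝ} (hs : 0 < s) (hs' : s ≠ 1 / 2) {ξ η : Ed d}
    (hξ : 1 / 4 < ‖ξ‖) (hη : 1 / 4 < ‖η‖)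
    (h : ∀ v, fderiv ℝ (smoothPow d s) ξ v = fderiv ℝ (smoothPow d s) η v) : ξ = η := by
  have hξ0 : 0 < ‖ξ‖ := by linarith
  have hη0 : 0 < ‖η‖ := by linarith
  have h1 : (2 * s * (‖ξ‖ ^ 2) ^ (s - 1)) • ξ = (2 * s * (‖η‖ ^ 2) ^ (s - 1)) • η := by
    refine ext_inner_right ℝ fun v => ?_
    rw [real_inner_smul_left, real_inner_smul_left, ← fderiv_smoothPow s hξ,
      ← fderiv_smoothPow s hη, h v]
  have h2 := congrArg norm h1
  rw [norm_grad_smoothPow s hs hξ0, norm_grad_smoothPow s hs hη0] at h2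
  have h3 : ‖ξ‖ ^ (2 * s - 1) = ‖η‖ ^ (2 * s - 1) := mul_left_cancel₀ (by positivity) h2
  have h4 : ‖ξ‖ = ‖η‖ :=
    (Real.rpow_left_inj hξ0.le hη0.le (fun h => hs' (by linarith))).1 h3
  rw [h4] at h1
  exact smul_right_injective _ (by positivity) h1

lemma gradSq_ne_zero {P : Type*} [NormedAddCommGroup P] [NormedSpace ℝ P] {Φ : P × Ed d → ℝ}
    {q : P × Ed d} {v : Ed d} (h : fderiv ℝ Φ q (0, v) ≠ 0) :
    gradSq (EuclideanSpace.basisFun (Fin d) ℝ) Φ q ≠ 0 := by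
  intro h0
  refine h ?_
  rw [gradSq, Finset.sum_eq_zero_iff_of_nonneg fun _ _ => sq_nonneg _] at h0
  have hv := (EuclideanSpace.basisFun (Fin d) ℝ).sum_repr v
  have : ((0 : P), v) = ContinuousLinearMap.inr ℝ P (Ed d) v := rfl
  rw [this, ← hv, map_sum, map_sum]
  refine Finset.sum_eq_zero fun j hj => ?_
  rw [map_smul, map_smul, ContinuousLinearMap.inr_apply, pow_eq_zero_iff two_ne_zero |>.1 (h0 j hj),
    smul_zero]

end Amplitudes

section Oscillatory

open scoped ContDiff Topology Convolution

/-- Smoothness of the average over the unit interval of a smooth function with parameters. -/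
lemma contDiff_integral_unitInterval {P : Type*} [NormedAddCommGroup P] [NormedSpace ℝ P]
    {F : P × ℝ → ℝ} (hF : ContDiff ℝ ∞ F) :
    ContDiff ℝ ∞ (fun p => ∫ u in (0 : ℝ)..1, F (p, u)) := by
  obtain ⟨κ, hκ, hκc, -, hκ1⟩ := exists_contDiff_cutoff (isCompact_Icc (a := (0 : ℝ)) (b := 1))
    isOpen_univ (Set.subset_univ _)
  set f : ℝ → ℝ := Set.indicator (Set.Ioc 0 1) 1
  set g : P → ℝ → ℝ := fun p y => F (p, -y) * κ (-y)
  have hf : LocallyIntegrable f volume :=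
    ((integrable_indicator_iff measurableSet_Ioc).2
      (integrableOn_const (by simp))).locallyIntegrable
  have hg : ContDiff ℝ ∞ (↿g) := by
    have h1 : ContDiff ℝ ∞ (fun q : P × ℝ => F (q.1, -q.2)) :=
      hF.comp (contDiff_fst.prodMk contDiff_snd.neg)
    exact h1.mul (hκ.comp contDiff_snd.neg)
  have hk : IsCompact ((fun y : ℝ => -y) '' tsupport κ) := hκc.isCompact.image continuous_neg
  have := contDiffOn_convolution_right_with_param_comp (n := ⊤) (μ := volume)
    (ContinuousLinearMap.mul ℝ ℝ) (s := Set.univ) (v := fun _ : P => (0 : ℝ)) contDiffOn_const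
    (f := f) (g := g) isOpen_univ hk (fun p x _ hx => by
      have : κ (-x) = 0 := by
        by_contra h
        exact hx ⟨-x, subset_tsupport κ h, by simp⟩
      simp [g, this]) hf hg.contDiffOn
  rw [contDiffOn_univ] at this
  convert this using 2 with p
  rw [convolution_def, intervalIntegral.integral_of_le zero_le_one, ← integral_indicator
    measurableSet_Ioc]
  congr 1
  ext u
  by_cases hu : u ∈ Set.Ioc (0 : ℝ) 1
  · simp [f, g, hu, hκ1 u ⟨hu.1.le, hu.2⟩]
  · simp [f, hu]

variable {d : ℕ}

/-- Bound for the square of an integral by the autocorrelation of the integrand. -/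
lemma norm_integral_sq_le {f : Ed d → ℂ} (hf : Continuous f) (hc : HasCompactSupport f) :
    ‖∫ ξ, f ξ‖ ^ 2 ≤ ∫ h, ‖∫ ξ, f (ξ + h) * (starRingEnd ℂ) (f ξ)‖ := by
  have hintg : Integrable (fun q : Ed d × Ed d => f (q.1 + q.2) * (starRingEnd ℂ) (f q.1))
      (volume.prod volume) := by
    refine Continuous.integrable_of_hasCompactSupport (by fun_prop) ?_
    have hK : IsCompact (tsupport f) := hc
    refine HasCompactSupport.of_support_subset_isCompact (hK.prod
      ((hK.prod hK).image (continuous_fst.sub continuous_snd))) ?_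
    rintro ⟨ξ, h⟩ hq
    have h1 : ξ ∈ tsupport f := subset_tsupport f fun h0 => hq (by simp [h0])
    have h2 : ξ + h ∈ tsupport f := subset_tsupport f fun h0 => hq (by simp [h0])
    exact ⟨h1, ⟨(ξ + h, ξ), ⟨h2, h1⟩, by simp⟩⟩
  have key : (∫ ξ, f ξ) * (starRingEnd ℂ) (∫ ξ, f ξ) =
      ∫ h, ∫ ξ, f (ξ + h) * (starRingEnd ℂ) (f ξ) := by
    rw [← integral_integral_swap hintg, ← integral_conj, ← integral_const_mul]
    congr 1
    ext ξ
    rw [integral_mul_const, integral_add_left_eq_self f ξ]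
  calc ‖∫ ξ, f ξ‖ ^ 2 = ‖(∫ ξ, f ξ) * (starRingEnd ℂ) (∫ ξ, f ξ)‖ := by
        rw [norm_mul, RCLike.norm_conj, sq]
    _ ≤ _ := by
        rw [key]
        exact norm_integral_le_integral_norm _

/-- The frequency-localized kernel at unit scale. -/
def unitKernel (d : ℕ) (s β t : ℝ) (x : Ed d) : ℂ :=
  ∫ ξ, exp (I * ((⟪x, ξ⟫ - t * ‖ξ‖ ^ (2 * s) : ℝ) : ℂ)) * (annulusAmp d β ξ : ℂ)

lemma unitKernel_eq (s β t : ℝ) (x : Ed d) : unitKernel d s β t x =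
    ∫ ξ, exp (I * ((⟪x, ξ⟫ - t * smoothPow d s ξ : ℝ) : ℂ)) * (annulusAmp d β ξ : ℂ) := by
  refine integral_congr_ae (Filter.Eventually.of_forall fun ξ => ?_)
  by_cases h : annulusAmp d β ξ = 0
  · simp [h]
  · simp only [smoothPow_eq s (by linarith [(annulusAmp_ne_zero h).1] : 1 / 4 ≤ ‖ξ‖)]

lemma contDiff_ofReal_annulusAmp (β : ℝ) : ContDiff ℝ ∞ (fun ξ => (annulusAmp d β ξ : ℂ)) :=
  ofRealCLM.contDiff.comp (contDiff_annulusAmp β)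

/-- The kernel decays rapidly away from the region where the phase is stationary. -/
lemma unitKernel_nonstationary (s β : ℝ) (hs : 0 < s) (M : ℕ) :
    ∃ C c₀ c₁ : ℝ, 0 ≤ C ∧ 0 < c₀ ∧ 0 < c₁ ∧ ∀ (t : ℝ) (x : Ed d), t ≠ 0 →
      (‖x‖ ≤ c₀ * |t| ∨ c₁ * |t| ≤ ‖x‖) → ‖unitKernel d s β t x‖ ≤ C / (1 + |t|) ^ M := by
  obtain ⟨c₀, c₁, hc₀, hc₁, hm⟩ : ∃ c₀ c₁ : ℝ, 0 < c₀ ∧ 0 < c₁ ∧ ∀ ξ ∈ unitAnnulus d,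
      c₀ < 2 * s * ‖ξ‖ ^ (2 * s - 1) ∧ 2 * s * ‖ξ‖ ^ (2 * s - 1) < c₁ := by
    have hcont : ContinuousOn (fun r : ℝ => 2 * s * r ^ (2 * s - 1)) (Set.Icc (1 / 2) 2) :=
      continuousOn_const.mul (continuousOn_id.rpow_const fun r hr => Or.inl (by
        have := hr.1; simp only [id]; linarith))
    have hne : (Set.Icc (1 / 2 : ℝ) 2).Nonempty := ⟨1, by norm_num, by norm_num⟩
    obtain ⟨r₀, hr₀, h₀⟩ := isCompact_Icc.exists_isMinOn hne hcont
    obtain ⟨r₁, hr₁, h₁⟩ := isCompact_Icc.exists_isMaxOn hne hcont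
    have hp (r : ℝ) (hr : r ∈ Set.Icc (1 / 2 : ℝ) 2) : 0 < 2 * s * r ^ (2 * s - 1) := by
      have : 0 < r := by linarith [hr.1]
      positivity
    refine ⟨2 * s * r₀ ^ (2 * s - 1) / 2, 2 * s * r₁ ^ (2 * s - 1) + 1, half_pos (hp _ hr₀),
      by linarith [hp _ hr₁], fun ξ hξ => ⟨?_, ?_⟩⟩
    · have := h₀ (a := ‖ξ‖) hξ
      simp only [Set.mem_ofPred_eq] at this
      linarith [hp _ hr₀]
    · have := h₁ (a := ‖ξ‖) hξ
      simp only [Set.mem_ofPred_eq] at this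
      linarith
  set Φ : (ℝ × Ed d) × Ed d → ℝ := fun q => ⟪q.1.2, q.2⟫ - q.1.1 * smoothPow d s q.2
  set a : (ℝ × Ed d) × Ed d → ℂ := fun q => (annulusAmp d β q.2 : ℂ)
  have hΦ : ContDiff ℝ ∞ Φ := (contDiff_fst.snd.inner ℝ contDiff_snd).sub
    (contDiff_fst.fst.mul ((contDiff_smoothPow s).comp contDiff_snd))
  have ha : ContDiff ℝ ∞ a := (contDiff_ofReal_annulusAmp β).comp contDiff_snd
  set Q : Set (ℝ × Ed d) := {p | ((|p.1| ≤ 1 ∧ ‖p.2‖ ≤ 1) ∧ (|p.1| = 1 ∨ ‖p.2‖ = 1)) ∧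
    (‖p.2‖ ≤ c₀ * |p.1| ∨ c₁ * |p.1| ≤ ‖p.2‖)}
  have hn1 : Continuous (fun p : ℝ × Ed d => |p.1|) := continuous_fst.abs
  have hn2 : Continuous (fun p : ℝ × Ed d => ‖p.2‖) := continuous_snd.norm
  have hQ : IsCompact Q := by
    refine (isCompact_closedBall (0 : ℝ × Ed d) 1).of_isClosed_subset ?_ fun p hp => ?_
    · refine IsClosed.inter (IsClosed.inter (IsClosed.inter ?_ ?_) (IsClosed.union ?_ ?_))
        (IsClosed.union ?_ ?_)
      · exact isClosed_le hn1 continuous_const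
      · exact isClosed_le hn2 continuous_const
      · exact isClosed_eq hn1 continuous_const
      · exact isClosed_eq hn2 continuous_const
      · exact isClosed_le hn2 (continuous_const.mul hn1)
      · exact isClosed_le (continuous_const.mul hn1) hn2
    · rw [mem_closedBall_zero_iff, Prod.norm_def]
      exact max_le hp.1.1.1 hp.1.1.2
  have hg : ∀ q ∈ Q ×ˢ unitAnnulus d, gradSq (EuclideanSpace.basisFun (Fin d) ℝ) Φ q ≠ 0 := by
    rintro ⟨⟨τ, v⟩, ξ⟩ ⟨⟨⟨-, h1⟩, h2⟩, hξ⟩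
    simp only at h1 h2
    have hξ4 : 1 / 4 < ‖ξ‖ := by linarith [hξ.1]
    set y : Ed d := (2 * s * (‖ξ‖ ^ 2) ^ (s - 1)) • ξ
    have hy : ‖y‖ = 2 * s * ‖ξ‖ ^ (2 * s - 1) := norm_grad_smoothPow s hs (by linarith)
    have hder (w : Ed d) : fderiv ℝ Φ ((τ, v), ξ) (0, w) = ⟪v - τ • y, w⟫ := by
      rw [← fderiv_slice hΦ]
      have e1 : HasFDerivAt (fun ξ : Ed d => ⟪v, ξ⟫) (innerSL ℝ v) ξ := (innerSL ℝ v).hasFDerivAt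
      have e2 : HasFDerivAt (smoothPow d s) (fderiv ℝ (smoothPow d s) ξ) ξ :=
        ((contDiff_smoothPow s).differentiable (by simp) ξ).hasFDerivAt
      have e3 := (e1.sub (e2.const_mul τ)).fderiv
      simp only [Φ]
      rw [show (fun x => ⟪v, x⟫ - τ * smoothPow d s x) =
        (fun ξ : Ed d => ⟪v, ξ⟫) - fun x => τ * smoothPow d s x from rfl, e3, inner_sub_left,
        real_inner_smul_left, real_inner_smul_left, ← fderiv_smoothPow s hξ4]
      simp
    refine gradSq_ne_zero (v := v - τ • y) ?_
    rw [hder, real_inner_self_eq_norm_sq]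
    refine pow_ne_zero 2 (norm_ne_zero_iff.2 fun h0 => ?_)
    have hv : ‖v‖ = |τ| * ‖y‖ := by rw [sub_eq_zero.1 h0, norm_smul, Real.norm_eq_abs]
    obtain ⟨m0, m1⟩ := hm ξ hξ
    rw [← hy] at m0 m1
    have hτ : 0 < |τ| := by
      rcases h1 with h1 | h1
      · rw [h1]; exact one_pos
      · rw [h1] at hv
        by_contra hn
        have : |τ| = 0 := le_antisymm (not_lt.1 hn) (abs_nonneg _)
        rw [this, zero_mul] at hv
        exact one_ne_zero hv
    rcases h2 with h2 | h2 <;> nlinarith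
  obtain ⟨C, hC, h⟩ := nonstationary_phase volume hΦ ha (hQ.prod isCompact_unitAnnulus) hg M
  refine ⟨C, c₀, c₁, hC, hc₀, hc₁, fun t x ht hx => ?_⟩
  have htpos : 0 < |t| := abs_pos.2 ht
  set l : ℝ := max |t| ‖x‖
  have htl : |t| ≤ l := le_max_left _ _
  have hl : 0 < l := htpos.trans_le htl
  have hp : ((t / l, l⁻¹ • x) : ℝ × Ed d) ∈ Q := by
    have e1 : |t / l| = |t| / l := by rw [abs_div, abs_of_pos hl]
    have e2 : ‖l⁻¹ • x‖ = ‖x‖ / l := by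
      rw [norm_smul, norm_inv, Real.norm_of_nonneg hl.le]; ring
    simp only [Q, Set.mem_ofPred_eq, e1, e2]
    refine ⟨⟨⟨(div_le_one hl).2 htl, (div_le_one hl).2 (le_max_right _ _)⟩, ?_⟩, ?_⟩
    · rcases max_choice |t| ‖x‖ with h | h
      · left; rw [← h]; exact div_self hl.ne'
      · right; rw [← h]; exact div_self hl.ne'
    · rw [← mul_div_assoc, ← mul_div_assoc, div_le_div_iff_of_pos_right hl,
        div_le_div_iff_of_pos_right hl]
      exact hx
  have key := h (t / l, l⁻¹ • x) (fun ξ hξ => ⟨hp, annulusAmp_ne_zero (ofReal_ne_zero.1 hξ)⟩) l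
  have heq : unitKernel d s β t x =
      ∫ ξ, exp (I * l * Φ ((t / l, l⁻¹ • x), ξ)) * a ((t / l, l⁻¹ • x), ξ) := by
    rw [unitKernel_eq]
    congr 1
    ext ξ
    congr 2
    rw [mul_assoc, ← ofReal_mul]
    congr 2
    simp only [Φ, real_inner_smul_left]
    field_simp
  rw [heq]
  refine key.trans ?_
  rw [abs_of_pos hl]
  gcongr

end Oscillatory

section Dispersive

open scoped ContDiff Topology

variable {d : ℕ}

/-- The difference quotient `(φ (ξ + r w) - φ ξ) / r` of the phase, at `((r, w), ξ)`. -/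
def phaseQuot (d : ℕ) (s : ℝ) (q : (ℝ × Ed d) × Ed d) : ℝ :=
  ∫ u in (0 : ℝ)..1, fderiv ℝ (smoothPow d s) (q.2 + (u * q.1.1) • q.1.2) q.1.2

lemma contDiff_phaseQuot (s : ℝ) : ContDiff ℝ ∞ (phaseQuot d s) := by
  refine contDiff_integral_unitInterval (F := fun z : ((ℝ × Ed d) × Ed d) × ℝ =>
    fderiv ℝ (smoothPow d s) (z.1.2 + (z.2 * z.1.1.1) • z.1.1.2) z.1.1.2) ?_
  have h1 : ContDiff ℝ ∞ (fderiv ℝ (smoothPow d s)) :=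
    (contDiff_smoothPow s).fderiv_right (m := ∞) le_rfl
  exact (h1.comp (by fun_prop)).clm_apply (by fun_prop)

lemma mul_phaseQuot (s r : ℝ) (w ξ : Ed d) :
    r * phaseQuot d s ((r, w), ξ) = smoothPow d s (ξ + r • w) - smoothPow d s ξ := by
  have hder (u : ℝ) : HasDerivAt (fun u : ℝ => smoothPow d s (ξ + (u * r) • w))
      (r * fderiv ℝ (smoothPow d s) (ξ + (u * r) • w) w) u := by
    have h1 : HasFDerivAt (smoothPow d s) (fderiv ℝ (smoothPow d s) (ξ + (u * r) • w))
        (ξ + (u * r) • w) := ((contDiff_smoothPow s).differentiable (by simp) _).hasFDerivAt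
    have h2 : HasDerivAt (fun u : ℝ => ξ + (u * r) • w) (r • w) u := by
      simpa using (((hasDerivAt_id u).mul_const r).smul_const w).const_add ξ
    have h3 := h1.comp_hasDerivAt u h2
    rw [map_smul, smul_eq_mul] at h3
    exact h3
  have hc : Continuous (fun u : ℝ => r * fderiv ℝ (smoothPow d s) (ξ + (u * r) • w) w) := by
    have h1 : Continuous (fderiv ℝ (smoothPow d s)) :=
      ((contDiff_smoothPow s).fderiv_right (m := ∞) le_rfl).continuous
    fun_prop
  have := intervalIntegral.integral_eq_sub_of_hasDerivAt (fun u _ => hder u)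
    (hc.intervalIntegrable 0 1)
  simpa [phaseQuot] using this

lemma gradSq_phaseQuot_ne_zero {s : ℝ} (hs : 0 < s) (hs' : s ≠ 1 / 2) {r : ℝ} {w ξ : Ed d}
    (hw : w ≠ 0) (hξ : ξ ∈ unitAnnulus d) (hξ' : ξ + r • w ∈ unitAnnulus d) :
    gradSq (EuclideanSpace.basisFun (Fin d) ℝ) (phaseQuot d s) ((r, w), ξ) ≠ 0 := by
  have h4 : 1 / 4 < ‖ξ‖ := by linarith [hξ.1]
  have h4' : 1 / 4 < ‖ξ + r • w‖ := by linarith [hξ'.1]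
  suffices ∃ v, fderiv ℝ (fun y => phaseQuot d s ((r, w), y)) ξ v ≠ 0 by
    obtain ⟨v, hv⟩ := this
    rw [fderiv_slice (contDiff_phaseQuot s)] at hv
    exact gradSq_ne_zero hv
  by_cases hr : r = 0
  · subst hr
    simpa [phaseQuot] using exists_fderiv_fderiv_smoothPow_ne_zero hs hs' h4 hw
  · by_contra! H
    have hdiff (y : Ed d) : HasFDerivAt (smoothPow d s) (fderiv ℝ (smoothPow d s) y) y :=
      ((contDiff_smoothPow s).differentiable (by simp) y).hasFDerivAt
    have hslice : HasFDerivAt (fun y => phaseQuot d s ((r, w), y))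
        (fderiv ℝ (fun y => phaseQuot d s ((r, w), y)) ξ) ξ := by
      have : ContDiff ℝ ∞ (fun y => phaseQuot d s ((r, w), y)) :=
        (contDiff_phaseQuot s).comp (contDiff_const.prodMk contDiff_id)
      exact (this.differentiable (by simp) ξ).hasFDerivAt
    have e1 := hslice.const_mul r
    simp only [mul_phaseQuot] at e1
    have e2 : HasFDerivAt (fun y => smoothPow d s (y + r • w) - smoothPow d s y)
        (fderiv ℝ (smoothPow d s) (ξ + r • w) - fderiv ℝ (smoothPow d s) ξ) ξ := by
      refine HasFDerivAt.sub ?_ (hdiff ξ)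
      exact (hasFDerivAt_comp_add_right (r • w)).2 (hdiff (ξ + r • w))
    have e3 := e1.unique e2
    have : ξ + r • w = ξ := eq_of_fderiv_smoothPow_eq hs hs' h4' h4 fun v => by
      have := congrArg (fun L => L v) e3
      simp only [smul_apply, H v, smul_zero, sub_apply] at this
      linarith
    simp [hr, hw] at this

/-- The dispersive estimate for the unit-scale kernel. -/
lemma unitKernel_dispersive (hd : 0 < d) (s β : ℝ) (hs : 0 < s) (hs' : s ≠ 1 / 2) :
    ∃ C : ℝ, 0 ≤ C ∧ ∀ (t : ℝ) (x : Ed d), t ≠ 0 →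
      ‖unitKernel d s β t x‖ ≤ C * |t| ^ (-((d : ℝ) / 2)) := by
  set a : (ℝ × Ed d) × Ed d → ℂ :=
    fun q => (annulusAmp d β (q.2 + q.1.1 • q.1.2) : ℂ) * (annulusAmp d β q.2 : ℂ)
  have ha : ContDiff ℝ ∞ a :=
    ((contDiff_ofReal_annulusAmp β).comp (by fun_prop)).mul
      ((contDiff_ofReal_annulusAmp β).comp contDiff_snd)
  set Z : Set ((ℝ × Ed d) × Ed d) := ((Set.Icc (0 : ℝ) 4 ×ˢ Metric.sphere (0 : Ed d) 1) ×ˢ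
    unitAnnulus d) ∩ (fun q => q.2 + q.1.1 • q.1.2) ⁻¹' unitAnnulus d
  have hZ : IsCompact Z :=
    ((isCompact_Icc.prod (isCompact_sphere _ _)).prod isCompact_unitAnnulus).inter_right
      (isCompact_unitAnnulus.isClosed.preimage (by fun_prop))
  have hg : ∀ q ∈ Z, gradSq (EuclideanSpace.basisFun (Fin d) ℝ) (phaseQuot d s) q ≠ 0 := by
    rintro ⟨⟨r, w⟩, ξ⟩ ⟨⟨⟨-, hw⟩, hξ⟩, hξ'⟩
    refine gradSq_phaseQuot_ne_zero hs hs' (norm_ne_zero_iff.1 ?_) hξ hξ'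
    rw [mem_sphere_zero_iff_norm.1 hw]
    exact one_ne_zero
  obtain ⟨C, hC, h⟩ := nonstationary_phase volume (contDiff_phaseQuot s) ha hZ hg (d + 1)
  set A : ℝ := ∫ y : Ed d, (1 + ‖y‖) ^ (-((d : ℝ) + 1))
  have hA : 0 ≤ A := integral_nonneg fun y => by positivity
  have hAint : Integrable (fun y : Ed d => (1 + ‖y‖) ^ (-((d : ℝ) + 1))) :=
    integrable_one_add_norm (by simp)
  refine ⟨Real.sqrt (C * A), Real.sqrt_nonneg _, fun t x ht => ?_⟩
  have htpos : 0 < |t| := abs_pos.2 ht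
  set f : Ed d → ℂ := fun ξ =>
    exp (I * ((⟪x, ξ⟫ - t * smoothPow d s ξ : ℝ) : ℂ)) * (annulusAmp d β ξ : ℂ)
  have hf : Continuous f := by
    have h1 := (contDiff_smoothPow (d := d) s).continuous
    have h2 := (contDiff_ofReal_annulusAmp (d := d) β).continuous
    fun_prop
  have hfc : HasCompactSupport f := by
    refine HasCompactSupport.of_support_subset_isCompact isCompact_unitAnnulus fun ξ hξ => ?_
    exact annulusAmp_ne_zero (ofReal_ne_zero.1 (right_ne_zero_of_mul hξ))
  have hinner (y : Ed d) : ‖∫ ξ, f (ξ + y) * (starRingEnd ℂ) (f ξ)‖ ≤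
      C * (1 + ‖t • y‖) ^ (-((d : ℝ) + 1)) := by
    obtain ⟨w, hw, hyw⟩ : ∃ w : Ed d, ‖w‖ = 1 ∧ y = ‖y‖ • w := by
      by_cases hy : y = 0
      · refine ⟨EuclideanSpace.single ⟨0, hd⟩ 1, by simp, by simp [hy]⟩
      · refine ⟨‖y‖⁻¹ • y, by simp [norm_smul, hy], ?_⟩
        rw [smul_smul, mul_inv_cancel₀ (norm_ne_zero_iff.2 hy), one_smul]
    have key := h (‖y‖, w) (fun ξ hξ => ?_) (-(t * ‖y‖))
    · have heq : ∫ ξ, f (ξ + y) * (starRingEnd ℂ) (f ξ) = exp (I * ((⟪x, y⟫ : ℝ) : ℂ)) *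
          ∫ ξ, exp (I * ((-(t * ‖y‖) : ℝ) : ℂ) * phaseQuot d s ((‖y‖, w), ξ)) *
            a ((‖y‖, w), ξ) := by
        rw [← integral_const_mul]
        congr 1
        ext ξ
        have hph := mul_phaseQuot s ‖y‖ w ξ
        rw [← hyw] at hph
        simp only [f, a, ← hyw, map_mul, conj_ofReal, ← exp_conj, conj_I]
        rw [← mul_assoc (exp _), ← Complex.exp_add, mul_mul_mul_comm, ← Complex.exp_add]
        congr 2
        have : I * ((-(t * ‖y‖) : ℝ) : ℂ) * (phaseQuot d s ((‖y‖, w), ξ) : ℂ) =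
            I * ((-t * (smoothPow d s (ξ + y) - smoothPow d s ξ) : ℝ) : ℂ) := by
          rw [← hph]; push_cast; ring
        rw [this, inner_add_right]
        push_cast
        ring
      rw [heq, norm_mul, mul_comm I, norm_exp_ofReal_mul_I, one_mul]
      refine key.trans (le_of_eq ?_)
      rw [abs_neg, abs_mul, abs_norm, norm_smul, Real.norm_eq_abs, Real.rpow_neg (by positivity),
        div_eq_mul_inv]
      norm_cast
    · have h1 := annulusAmp_ne_zero (ofReal_ne_zero.1 (left_ne_zero_of_mul hξ))
      have h2 := annulusAmp_ne_zero (ofReal_ne_zero.1 (right_ne_zero_of_mul hξ))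
      simp only [← hyw] at h1 h2
      refine ⟨⟨⟨⟨norm_nonneg _, ?_⟩, by simpa using hw⟩, h2⟩, ?_⟩
      · have : ‖y‖ ≤ ‖ξ + y‖ + ‖ξ‖ := by
          simpa using norm_sub_le (ξ + y) ξ
        simp only
        linarith [h1.2, h2.2]
      · simp only [Set.mem_preimage, ← hyw]
        exact h1
  have hsq : ‖unitKernel d s β t x‖ ^ 2 ≤ C * A * |t| ^ (-(d : ℝ)) := by
    rw [unitKernel_eq]
    refine (norm_integral_sq_le hf hfc).trans ?_
    calc ∫ y, ‖∫ ξ, f (ξ + y) * (starRingEnd ℂ) (f ξ)‖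
        ≤ ∫ y : Ed d, C * (1 + ‖t • y‖) ^ (-((d : ℝ) + 1)) :=
          integral_mono_of_nonneg (Filter.Eventually.of_forall fun y => norm_nonneg _)
            ((hAint.comp_smul ht).const_mul C) (Filter.Eventually.of_forall hinner)
      _ = C * A * |t| ^ (-(d : ℝ)) := by
          rw [integral_const_mul,
            Measure.integral_comp_smul volume (fun y : Ed d => (1 + ‖y‖) ^ (-((d : ℝ) + 1))) t,
            Real.rpow_neg htpos.le, Real.rpow_natCast]
          simp [A, abs_inv, abs_pow]
          ring
  have hexp : (|t| ^ (-((d : ℝ) / 2))) ^ 2 = |t| ^ (-(d : ℝ)) := by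
    rw [← Real.rpow_natCast, ← Real.rpow_mul htpos.le]
    congr 1; push_cast; ring
  refine le_of_sq_le_sq ?_ (by positivity)
  rw [mul_pow, Real.sq_sqrt (by positivity), hexp]
  exact hsq

end Dispersive

section DyadicSum

lemma exists_sum_exp_neg_abs_le {a : ℝ} (ha : a ≠ 0) :
    ∃ B : ℝ, 0 ≤ B ∧ ∀ (b : ℝ) (J : ℕ),
      ∑ j ∈ Finset.range J, Real.exp (-|a * j + b|) ≤ B := by
  have ha' : 0 < |a| := abs_pos.2 ha
  set f : ℤ → ℝ := fun n => Real.exp (-(|a| * |(n : ℝ)|))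
  have hgeo : Summable (fun n : ℕ => Real.exp (-(|a| * n))) := by
    have := Real.summable_exp_nat_mul_iff.2 (neg_lt_zero.2 ha')
    refine this.congr fun n => ?_
    congr 1; ring
  have hf : Summable f := by
    refine Summable.of_nat_of_neg ?_ ?_
    · simpa [f] using hgeo
    · simpa [f] using hgeo
  refine ⟨Real.exp |a| * ∑' n, f n, mul_nonneg (Real.exp_nonneg _)
    (tsum_nonneg fun n => Real.exp_nonneg _), fun b J => ?_⟩
  set k : ℤ := ⌊b / a⌋
  have hterm (j : ℕ) : Real.exp (-|a * j + b|) ≤ Real.exp |a| * f (j + k) := by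
    rw [← Real.exp_add, Real.exp_le_exp]
    have h1 : |a * j + b| = |a| * |(j : ℝ) + b / a| := by
      rw [← abs_mul]; congr 1; field_simp
    have h2 : |((j + k : ℤ) : ℝ)| ≤ |(j : ℝ) + b / a| + 1 := by
      have h3 : |(j : ℝ) + k - (j + b / a)| ≤ 1 := by
        rw [add_sub_add_left_eq_sub, abs_le]
        constructor <;> linarith [Int.floor_le (b / a), Int.lt_floor_add_one (b / a)]
      have := abs_add_le ((j : ℝ) + b / a) ((j : ℝ) + k - (j + b / a))
      rw [add_sub_cancel] at this
      push_cast
      linarith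
    rw [h1]
    nlinarith
  calc ∑ j ∈ Finset.range J, Real.exp (-|a * j + b|)
      ≤ ∑ j ∈ Finset.range J, Real.exp |a| * f (j + k) := Finset.sum_le_sum fun j _ => hterm j
    _ = Real.exp |a| * ∑ j ∈ Finset.range J, f (j + k) := by rw [Finset.mul_sum]
    _ ≤ Real.exp |a| * ∑' n, f n := by
        gcongr
        have hinj : Function.Injective (fun j : ℕ => (j : ℤ) + k) := fun i j h => by simpa using h
        rw [← Finset.sum_image (f := f) (g := fun j : ℕ => (j : ℤ) + k) hinj.injOn]
        exact hf.sum_le_tsum _ fun n _ => Real.exp_nonneg _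

variable {d : ℕ}

lemma norm_unitKernel_le (s β t : ℝ) (x : Ed d) :
    ‖unitKernel d s β t x‖ ≤ ∫ ξ, |annulusAmp d β ξ| := by
  refine (norm_integral_le_integral_norm _).trans (le_of_eq ?_)
  congr 1
  ext ξ
  rw [norm_mul, mul_comm I, norm_exp_ofReal_mul_I, one_mul, norm_real, Real.norm_eq_abs]

/-- The weighted unit-scale kernel is bounded by terms that are summable over dyadic scales. -/
lemma exists_rpow_mul_norm_unitKernel_le (hd : 0 < d) {s : ℝ} (β : ℝ) (hs : 0 < s)
    (hs' : s ≠ 1 / 2) {θ : ℝ} (hθ : 0 < θ) (hθd : θ ≤ d / 2) :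
    ∃ C : ℝ, 0 ≤ C ∧ ∀ (t : ℝ) (x : Ed d), t ≠ 0 →
      |t| ^ θ * ‖unitKernel d s β t x‖ ≤ C * (Real.exp (-|min θ 1 * Real.log (|t|)|) +
        if x = 0 then 0 else Real.exp (-|Real.log (‖x‖ / |t|)|)) := by
  obtain ⟨C₁, c₀, c₁, hC₁, hc₀, hc₁, h₁⟩ := unitKernel_nonstationary (d := d) s β hs (d + 1)
  obtain ⟨C₂, hC₂, h₂⟩ := unitKernel_dispersive hd s β hs hs'
  set C₀ : ℝ := ∫ ξ, |annulusAmp d β ξ|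
  have hC₀ : 0 ≤ C₀ := integral_nonneg fun _ => abs_nonneg _
  set L : ℝ := |Real.log c₀| + |Real.log c₁|
  set ε : ℝ := min θ 1
  have hε : 0 < ε := lt_min hθ one_pos
  refine ⟨C₀ + C₁ + C₂ * Real.exp L, by positivity, fun t x ht => ?_⟩
  have hT : 0 < |t| := abs_pos.2 ht
  set T := |t|
  set E₁ := Real.exp (-|ε * Real.log T|)
  set E₂ : ℝ := if x = 0 then 0 else Real.exp (-|Real.log (‖x‖ / T)|)
  have hE₁ : 0 ≤ E₁ := Real.exp_nonneg _
  have hE₂ : 0 ≤ E₂ := by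
    simp only [E₂]; split_ifs
    · exact le_rfl
    · exact Real.exp_nonneg _
  have hexpand : (C₀ + C₁ + C₂ * Real.exp L) * (E₁ + E₂) = C₀ * E₁ + C₁ * E₁ +
      C₂ * (Real.exp L * E₂) + (C₀ * E₂ + C₁ * E₂ + C₂ * Real.exp L * E₁) := by ring
  have hrest : 0 ≤ C₀ * E₂ + C₁ * E₂ + C₂ * Real.exp L * E₁ := by positivity
  have p0 : 0 ≤ C₀ * E₁ := by positivity
  have p1 : 0 ≤ C₁ * E₁ := by positivity
  have p2 : 0 ≤ C₂ * (Real.exp L * E₂) := by positivity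
  rcases le_total T 1 with hT1 | hT1
  · have e1 : E₁ = T ^ ε := by
      have : ε * Real.log T ≤ 0 := mul_nonpos_of_nonneg_of_nonpos hε.le
        (Real.log_nonpos hT.le hT1)
      simp only [E₁]
      rw [abs_of_nonpos this, neg_neg, Real.rpow_def_of_pos hT, mul_comm]
    have e2 : T ^ θ ≤ E₁ := by
      rw [e1]
      exact Real.rpow_le_rpow_of_exponent_ge hT hT1 (min_le_left _ _)
    have : T ^ θ * ‖unitKernel d s β t x‖ ≤ E₁ * C₀ := by
      gcongr
      exact norm_unitKernel_le s β t x
    linarith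
  · have e1 : E₁ = T ^ (-ε) := by
      have : 0 ≤ ε * Real.log T := mul_nonneg hε.le (Real.log_nonneg hT1)
      simp only [E₁]
      rw [abs_of_nonneg this, Real.rpow_def_of_pos hT, mul_neg, mul_comm]
    by_cases hx : ‖x‖ ≤ c₀ * T ∨ c₁ * T ≤ ‖x‖
    · have e2 : T ^ θ * ‖unitKernel d s β t x‖ ≤ C₁ * E₁ := by
        calc T ^ θ * ‖unitKernel d s β t x‖ ≤ T ^ θ * (C₁ / (1 + T) ^ (d + 1)) := by
              gcongr; exact h₁ t x ht hx
          _ ≤ T ^ θ * (C₁ / T ^ (d + 1)) := by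
              gcongr; linarith
          _ = C₁ * T ^ (θ - (d + 1)) := by
              rw [Real.rpow_sub hT]
              norm_cast
              ring
          _ ≤ C₁ * E₁ := by
              rw [e1]
              gcongr
              · have : ε ≤ 1 := min_le_right _ _
                have : (0 : ℝ) ≤ d := Nat.cast_nonneg d
                linarith
      linarith
    · push Not at hx
      have hx0 : 0 < ‖x‖ := lt_trans (by positivity) hx.1
      have hz0 : c₀ < ‖x‖ / T := (lt_div_iff₀ hT).2 hx.1
      have hz1 : ‖x‖ / T < c₁ := (div_lt_iff₀ hT).2 hx.2
      have e2 : E₂ = Real.exp (-|Real.log (‖x‖ / T)|) := if_neg (norm_pos_iff.1 hx0)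
      have e3 : 1 ≤ Real.exp L * E₂ := by
        rw [e2, ← Real.exp_add, Real.one_le_exp_iff]
        have l0 := Real.log_le_log hc₀ hz0.le
        have l1 := Real.log_le_log (by positivity) hz1.le
        have : |Real.log (‖x‖ / T)| ≤ L := by
          rw [abs_le]
          constructor
          · linarith [neg_abs_le (Real.log c₀), abs_nonneg (Real.log c₁)]
          · linarith [le_abs_self (Real.log c₁), abs_nonneg (Real.log c₀)]
        linarith
      have e4 : T ^ θ * ‖unitKernel d s β t x‖ ≤ C₂ := by
        calc T ^ θ * ‖unitKernel d s β t x‖ ≤ T ^ θ * (C₂ * T ^ (-((d : ℝ) / 2))) := by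
              gcongr; exact h₂ t x ht
          _ = C₂ * T ^ (θ - d / 2) := by
              rw [sub_eq_add_neg, Real.rpow_add hT]; ring
          _ ≤ C₂ * 1 := by
              gcongr
              exact Real.rpow_le_one_of_one_le_of_nonpos hT1 (by linarith)
          _ = C₂ := mul_one _
      have : C₂ * 1 ≤ C₂ * (Real.exp L * E₂) := by gcongr
      linarith

/-- The kernel localized to frequencies of size `N`. -/
def scaleKernel (d : ℕ) (s β t N : ℝ) (x : Ed d) : ℂ :=
  ∫ ξ, exp (I * ((⟪x, ξ⟫ - t * ‖ξ‖ ^ (2 * s) : ℝ) : ℂ)) *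
    ((‖ξ‖ ^ β * annulusBump d (N⁻¹ • ξ) : ℝ) : ℂ)

lemma scaleKernel_eq (s β t : ℝ) {N : ℝ} (hN : 0 < N) (x : Ed d) :
    scaleKernel d s β t N x =
      ((N ^ ((d : ℝ) + β) : ℝ) : ℂ) * unitKernel d s β (N ^ (2 * s) * t) (N • x) := by
  have h := Measure.integral_comp_smul volume (fun ξ : Ed d =>
    exp (I * ((⟪x, ξ⟫ - t * ‖ξ‖ ^ (2 * s) : ℝ) : ℂ)) *
    ((‖ξ‖ ^ β * annulusBump d (N⁻¹ • ξ) : ℝ) : ℂ)) N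
  have h2 : ∀ ξ : Ed d, exp (I * ((⟪x, N • ξ⟫ - t * ‖N • ξ‖ ^ (2 * s) : ℝ) : ℂ)) *
      ((‖N • ξ‖ ^ β * annulusBump d (N⁻¹ • N • ξ) : ℝ) : ℂ) = ((N ^ β : ℝ) : ℂ) *
      (exp (I * ((⟪N • x, ξ⟫ - N ^ (2 * s) * t * ‖ξ‖ ^ (2 * s) : ℝ) : ℂ)) *
        (annulusAmp d β ξ : ℂ)) := fun ξ => by
    rw [inv_smul_smul₀ hN.ne', norm_smul, Real.norm_of_nonneg hN.le,
      Real.mul_rpow hN.le (norm_nonneg _), Real.mul_rpow hN.le (norm_nonneg _),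
      real_inner_smul_right, real_inner_smul_left, annulusAmp, mul_left_comm t, mul_assoc (N ^ β),
      ofReal_mul (N ^ β), mul_left_comm (exp _), mul_assoc (N ^ (2 * s))]
  simp only [h2] at h
  rw [integral_const_mul, finrank_euclideanSpace_fin, abs_of_nonneg (by positivity)] at h
  rw [Real.rpow_add hN, Real.rpow_natCast, ofReal_mul, mul_assoc, unitKernel, h, scaleKernel,
    real_smul, ← mul_assoc, ← ofReal_mul, mul_inv_cancel₀ (by positivity), ofReal_one, one_mul]

/-- Uniform bound for the sum of the dyadic kernels. -/
lemma exists_sum_norm_scaleKernel_le (hd : 0 < d) {s β : ℝ} (hs : 0 < s) (hs' : s ≠ 1 / 2)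
    {θ : ℝ} (hθ : 0 < θ) (hθd : θ ≤ d / 2) (hβθ : d + β ≤ 2 * s * θ) :
    ∃ C : ℝ, 0 ≤ C ∧ ∀ (t : ℝ) (x : Ed d) (J : ℕ), t ≠ 0 →
      ∑ j ∈ Finset.range J, ‖scaleKernel d s β t (2 ^ j / 2) x‖ ≤ C * |t| ^ (-θ) := by
  obtain ⟨C, hC, h⟩ := exists_rpow_mul_norm_unitKernel_le hd β hs hs' hθ hθd
  set ε : ℝ := min θ 1
  have hε : 0 < ε := lt_min hθ one_pos
  have hlog2 : 0 < Real.log 2 := Real.log_pos one_lt_two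
  obtain ⟨B₁, hB₁, hs₁⟩ := exists_sum_exp_neg_abs_le
    (show ε * (2 * s) * Real.log 2 ≠ 0 by positivity)
  obtain ⟨B₂, hB₂, hs₂⟩ := exists_sum_exp_neg_abs_le
    (show (1 - 2 * s) * Real.log 2 ≠ 0 from
      mul_ne_zero (fun h => hs' (by linarith)) hlog2.ne')
  set D : ℝ := (1 / 2 : ℝ) ^ ((d : ℝ) + β - 2 * s * θ)
  have hD : 0 ≤ D := by positivity
  refine ⟨D * C * (B₁ + B₂), by positivity, fun t x J ht => ?_⟩
  have hT : 0 < |t| := abs_pos.2 ht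
  set b₁ : ℝ := ε * Real.log |t| - ε * (2 * s) * Real.log 2
  set b₂ : ℝ := Real.log ‖x‖ - Real.log |t| - (1 - 2 * s) * Real.log 2
  have hterm (j : ℕ) : ‖scaleKernel d s β t (2 ^ j / 2) x‖ ≤ D * C * |t| ^ (-θ) *
      (Real.exp (-|ε * (2 * s) * Real.log 2 * j + b₁|) +
        Real.exp (-|(1 - 2 * s) * Real.log 2 * j + b₂|)) := by
    have hN2 : (1 / 2 : ℝ) ≤ 2 ^ j / 2 := by
      have : (1 : ℝ) ≤ 2 ^ j := one_le_pow₀ one_le_two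
      linarith
    have hlogN : Real.log (2 ^ j / 2 : ℝ) = j * Real.log 2 - Real.log 2 := by
      rw [Real.log_div (by positivity) two_ne_zero, Real.log_pow]
    set N : ℝ := 2 ^ j / 2
    have hN : 0 < N := by linarith
    have hNs : 0 < N ^ (2 * s) := by positivity
    have habs : |N ^ (2 * s) * t| = N ^ (2 * s) * |t| := by rw [abs_mul, abs_of_pos hNs]
    have hNx : (N • x = 0) = (x = 0) := by simp [hN.ne']
    have hpow : N ^ ((d : ℝ) + β) ≤ D * |t| ^ (-θ) * (N ^ (2 * s) * |t|) ^ θ := by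
      have e1 : N ^ ((d : ℝ) + β - 2 * s * θ) ≤ D :=
        Real.rpow_le_rpow_of_nonpos (by norm_num) hN2 (by linarith)
      calc N ^ ((d : ℝ) + β) = N ^ ((d : ℝ) + β - 2 * s * θ) * N ^ (2 * s * θ) := by
            rw [← Real.rpow_add hN]; congr 1; ring
        _ ≤ D * N ^ (2 * s * θ) := by gcongr
        _ = D * |t| ^ (-θ) * (N ^ (2 * s) * |t|) ^ θ := by
            rw [Real.mul_rpow hNs.le hT.le, ← Real.rpow_mul hN.le, Real.rpow_neg hT.le]
            field_simp
    have hmain := h (N ^ (2 * s) * t) (N • x) (mul_ne_zero hNs.ne' ht)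
    simp only [habs, hNx, norm_smul, Real.norm_of_nonneg hN.le] at hmain
    have hlogT : Real.log (N ^ (2 * s) * |t|) = 2 * s * Real.log N + Real.log |t| := by
      rw [Real.log_mul hNs.ne' hT.ne', Real.log_rpow hN]
    have hfirst : ε * Real.log (N ^ (2 * s) * |t|) = ε * (2 * s) * Real.log 2 * j + b₁ := by
      rw [hlogT, hlogN]; simp only [b₁]; ring
    have hsecond : (if x = 0 then 0 else Real.exp (-|Real.log (N * ‖x‖ / (N ^ (2 * s) * |t|))|)) ≤
        Real.exp (-|(1 - 2 * s) * Real.log 2 * j + b₂|) := by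
      split_ifs with hx
      · exact Real.exp_nonneg _
      · have hx' : ‖x‖ ≠ 0 := norm_ne_zero_iff.2 hx
        rw [Real.log_div (by positivity) (by positivity), Real.log_mul hN.ne' hx', hlogT, hlogN]
        refine le_of_eq ?_
        congr 3
        simp only [b₂]; ring
    rw [scaleKernel_eq s β t hN, norm_mul, norm_real, Real.norm_of_nonneg (by positivity)]
    calc N ^ ((d : ℝ) + β) * ‖unitKernel d s β (N ^ (2 * s) * t) (N • x)‖
        ≤ D * |t| ^ (-θ) * (N ^ (2 * s) * |t|) ^ θ *
            ‖unitKernel d s β (N ^ (2 * s) * t) (N • x)‖ := by gcongr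
      _ = D * |t| ^ (-θ) * ((N ^ (2 * s) * |t|) ^ θ *
            ‖unitKernel d s β (N ^ (2 * s) * t) (N • x)‖) := by ring
      _ ≤ D * |t| ^ (-θ) * (C * (Real.exp (-|ε * (2 * s) * Real.log 2 * j + b₁|) +
        Real.exp (-|(1 - 2 * s) * Real.log 2 * j + b₂|))) := by
          rw [hfirst] at hmain
          refine mul_le_mul_of_nonneg_left (hmain.trans ?_) (by positivity)
          gcongr
      _ = _ := by ring
  calc ∑ j ∈ Finset.range J, ‖scaleKernel d s β t (2 ^ j / 2) x‖
      ≤ ∑ j ∈ Finset.range J, D * C * |t| ^ (-θ) *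
      (Real.exp (-|ε * (2 * s) * Real.log 2 * j + b₁|) +
        Real.exp (-|(1 - 2 * s) * Real.log 2 * j + b₂|)) := Finset.sum_le_sum fun j _ => hterm j
    _ = D * C * |t| ^ (-θ) * (∑ j ∈ Finset.range J, Real.exp (-|ε * (2 * s) * Real.log 2 * j + b₁|)
        + ∑ j ∈ Finset.range J, Real.exp (-|(1 - 2 * s) * Real.log 2 * j + b₂|)) := by
        rw [← Finset.mul_sum, Finset.sum_add_distrib]
    _ ≤ D * C * |t| ^ (-θ) * (B₁ + B₂) := by
        gcongr
        · exact hs₁ b₁ J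
        · exact hs₂ b₂ J
    _ = _ := by ring

end DyadicSum

section Assembly

open Filter Topology

variable {d : ℕ}

lemma annulusBump_smul_eq (j : ℕ) (ξ : Ed d) : annulusBump d ((2 ^ j / 2 : ℝ)⁻¹ • ξ) =
    unitBump d ((4 / 2 ^ (j + 1) : ℝ) • ξ) - unitBump d ((4 / 2 ^ j : ℝ) • ξ) := by
  rw [annulusBump, smul_smul,
    show (2 ^ j / 2 : ℝ)⁻¹ = 4 / 2 ^ (j + 1) by rw [pow_succ]; field_simp; norm_num,
    show (2 : ℝ) * (4 / 2 ^ (j + 1)) = 4 / 2 ^ j by rw [pow_succ]; field_simp]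

lemma sum_annulusBump_smul (J : ℕ) {ξ : Ed d} (hξ : 1 / 2 ≤ ‖ξ‖) :
    ∑ j ∈ Finset.range J, annulusBump d ((2 ^ j / 2 : ℝ)⁻¹ • ξ) =
      unitBump d ((4 / 2 ^ J : ℝ) • ξ) := by
  simp only [annulusBump_smul_eq]
  rw [Finset.sum_range_sub (fun j : ℕ => unitBump d ((4 / 2 ^ j : ℝ) • ξ)),
    unitBump_eq_zero (ξ := (4 / 2 ^ 0 : ℝ) • ξ), sub_zero]
  rw [norm_smul]
  norm_num
  linarith

lemma tendsto_unitBump_smul (ξ : Ed d) :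
    Tendsto (fun J : ℕ => unitBump d ((4 / 2 ^ J : ℝ) • ξ)) atTop (𝓝 1) := by
  have h1 : Tendsto (fun J : ℕ => (4 / 2 ^ J : ℝ) • ξ) atTop (𝓝 ((0 : ℝ) • ξ)) := by
    refine Tendsto.smul_const ?_ ξ
    exact tendsto_const_nhds.div_atTop (tendsto_pow_atTop_atTop_of_one_lt one_lt_two)
  have h2 := ((unitBump d).continuous.tendsto _).comp h1
  rwa [zero_smul, unitBump_eq_one (by simp)] at h2

/-- The multiplier of a dyadic piece. -/
def scaleAmp (d : ℕ) (β N : ℝ) (ξ : Ed d) : ℝ := ‖ξ‖ ^ β * annulusBump d (N⁻¹ • ξ)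

lemma integrable_scaleAmp (β : ℝ) {N : ℝ} (hN : 0 < N) : Integrable (scaleAmp d β N) := by
  have h1 : Integrable (annulusAmp d β) :=
    (contDiff_annulusAmp β).continuous.integrable_of_hasCompactSupport
      (hasCompactSupport_annulusAmp β)
  have h2 := (h1.comp_smul (inv_ne_zero hN.ne')).const_mul (N ^ β)
  refine h2.congr (Eventually.of_forall fun ξ => ?_)
  simp only [annulusAmp, scaleAmp]
  rw [norm_smul, Real.norm_of_nonneg (by positivity), Real.mul_rpow (by positivity)
    (norm_nonneg _), Real.inv_rpow hN.le]
  field_simp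

/-- Integrating a dyadic multiplier against a Fourier transform is a convolution. -/
lemma integral_mul_fourier_eq (s β t : ℝ) {N : ℝ} (hN : 0 < N) (x : Ed d) {u : Ed d → ℂ}
    (hu : Integrable u) :
    Integrable (fun y => scaleKernel d s β t N (x - y) * u y) ∧
    ∫ ξ : Ed d, exp (I * ((⟪x, ξ⟫ - t * ‖ξ‖ ^ (2 * s) : ℝ) : ℂ)) * (scaleAmp d β N ξ : ℂ) *
        (∫ y : Ed d, exp (-I * ((⟪y, ξ⟫ : ℝ) : ℂ)) * u y) =
      ∫ y : Ed d, scaleKernel d s β t N (x - y) * u y := by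
  have hintg : Integrable (fun p : Ed d × Ed d =>
      exp (I * ((⟪x - p.2, p.1⟫ - t * ‖p.1‖ ^ (2 * s) : ℝ) : ℂ)) *
        ((scaleAmp d β N p.1 : ℂ) * u p.2)) (volume.prod volume) := by
    refine ((integrable_scaleAmp β hN).ofReal.mul_prod hu).bdd_mul (c := 1) ?_ ?_
    · refine Measurable.aestronglyMeasurable ?_
      fun_prop
    · refine Eventually.of_forall fun p => ?_
      rw [mul_comm, norm_exp_ofReal_mul_I]
  have hK (y : Ed d) : ∫ ξ : Ed d, exp (I * ((⟪x - y, ξ⟫ - t * ‖ξ‖ ^ (2 * s) : ℝ) : ℂ)) *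
        ((scaleAmp d β N ξ : ℂ) * u y) = scaleKernel d s β t N (x - y) * u y := by
    rw [scaleKernel, ← integral_mul_const]
    simp only [scaleAmp, mul_assoc]
  refine ⟨hintg.integral_prod_right.congr (Eventually.of_forall hK), ?_⟩
  have h1 := integral_integral_swap (f := fun ξ y : Ed d =>
    exp (I * ((⟪x - y, ξ⟫ - t * ‖ξ‖ ^ (2 * s) : ℝ) : ℂ)) * ((scaleAmp d β N ξ : ℂ) * u y)) hintg
  refine Eq.trans (integral_congr_ae (Eventually.of_forall fun ξ => ?_))
    (h1.trans (integral_congr_ae (Eventually.of_forall hK)))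
  simp only
  rw [← integral_const_mul]
  refine integral_congr_ae (Eventually.of_forall fun y => ?_)
  simp only
  have : exp (I * ((⟪x - y, ξ⟫ - t * ‖ξ‖ ^ (2 * s) : ℝ) : ℂ)) =
      exp (I * ((⟪x, ξ⟫ - t * ‖ξ‖ ^ (2 * s) : ℝ) : ℂ)) * exp (-I * ((⟪y, ξ⟫ : ℝ) : ℂ)) := by
    rw [← exp_add, inner_sub_left]
    congr 1
    push_cast
    ring
  rw [this]
  ring

/-- Bound for the frequency-localized evolution. -/
lemma exists_norm_integral_le (hd : 0 < d) {s β : ℝ} (hs : 0 < s) (hs' : s ≠ 1 / 2)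
    {θ : ℝ} (hθ : 0 < θ) (hθd : θ ≤ d / 2) (hβθ : d + β ≤ 2 * s * θ) :
    ∃ C : ℝ, 0 ≤ C ∧ ∀ (t : ℝ), t ≠ 0 → ∀ (x : Ed d) (u : Ed d → ℂ), Integrable u →
      (∀ ξ : Ed d, (∫ y : Ed d, exp (-I * ((⟪y, ξ⟫ : ℝ) : ℂ)) * u y) ≠ 0 → 1 / 2 ≤ ‖ξ‖) →
      ‖∫ ξ : Ed d, exp (I * ((⟪x, ξ⟫ - t * ‖ξ‖ ^ (2 * s) : ℝ) : ℂ)) * ((‖ξ‖ ^ β : ℝ) : ℂ) *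
        (∫ y : Ed d, exp (-I * ((⟪y, ξ⟫ : ℝ) : ℂ)) * u y)‖ ≤ C * |t| ^ (-θ) * ∫ y, ‖u y‖ := by
  obtain ⟨C, hC, h⟩ := exists_sum_norm_scaleKernel_le hd hs hs' hθ hθd hβθ
  refine ⟨C, hC, fun t ht x u hu hsupp => ?_⟩
  set F : Ed d → ℂ := fun ξ => ∫ y : Ed d, exp (-I * ((⟪y, ξ⟫ : ℝ) : ℂ)) * u y with hF
  set G : Ed d → ℂ := fun ξ =>
    exp (I * ((⟪x, ξ⟫ - t * ‖ξ‖ ^ (2 * s) : ℝ) : ℂ)) * ((‖ξ‖ ^ β : ℝ) : ℂ) * F ξ with hG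
  change ‖∫ ξ, G ξ‖ ≤ _
  by_cases hGi : Integrable G
  swap
  · rw [integral_undef hGi, norm_zero]
    have := integral_nonneg (μ := volume) (f := fun y => ‖u y‖) (fun y => norm_nonneg (u y))
    positivity
  have hlim : Tendsto (fun J : ℕ => ∫ ξ, (unitBump d ((4 / 2 ^ J : ℝ) • ξ) : ℂ) * G ξ) atTop
      (𝓝 (∫ ξ, G ξ)) := by
    refine tendsto_integral_of_dominated_convergence (fun ξ => ‖G ξ‖) (fun J => ?_) hGi.norm
      (fun J => Eventually.of_forall fun ξ => ?_) (Eventually.of_forall fun ξ => ?_)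
    · refine AEStronglyMeasurable.mul (Continuous.aestronglyMeasurable ?_) hGi.1
      exact continuous_ofReal.comp (contDiff_unitBump_smul _).continuous
    · rw [norm_mul, norm_real, Real.norm_of_nonneg (unitBump d).nonneg]
      exact mul_le_of_le_one_left (norm_nonneg _) (unitBump d).le_one
    · simpa using ((continuous_ofReal.tendsto _).comp (tendsto_unitBump_smul ξ)).mul_const (G ξ)
  refine le_of_tendsto hlim.norm (Eventually.of_forall fun J => ?_)
  have hsum : ∀ ξ, (unitBump d ((4 / 2 ^ J : ℝ) • ξ) : ℂ) * G ξ = ∑ j ∈ Finset.range J,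
      exp (I * ((⟪x, ξ⟫ - t * ‖ξ‖ ^ (2 * s) : ℝ) : ℂ)) * (scaleAmp d β (2 ^ j / 2) ξ : ℂ) *
        F ξ := fun ξ => by
    by_cases h0 : F ξ = 0
    · simp [hG, h0]
    rw [← sum_annulusBump_smul J (hsupp ξ h0), ofReal_sum, Finset.sum_mul]
    refine Finset.sum_congr rfl fun j _ => ?_
    simp only [hG, scaleAmp, ofReal_mul]
    ring
  have hNpos (j : ℕ) : (0 : ℝ) < 2 ^ j / 2 := by positivity
  have hnorm (ξ y : Ed d) : ‖exp (-I * ((⟪y, ξ⟫ : ℝ) : ℂ)) * u y‖ = ‖u y‖ := by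
    rw [norm_mul, show -I * ((⟪y, ξ⟫ : ℝ) : ℂ) = ((-⟪y, ξ⟫ : ℝ) : ℂ) * I by push_cast; ring,
      norm_exp_ofReal_mul_I, one_mul]
  have hFm : Continuous F := by
    refine continuous_of_dominated (bound := fun y => ‖u y‖) (fun ξ => ?_) (fun ξ => ?_)
      hu.norm (Eventually.of_forall fun y => by fun_prop)
    · exact AEStronglyMeasurable.mul (Continuous.aestronglyMeasurable (by fun_prop)) hu.1
    · exact Eventually.of_forall fun y => (hnorm ξ y).le
  have hFb (ξ : Ed d) : ‖F ξ‖ ≤ ∫ y, ‖u y‖ :=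
    (norm_integral_le_integral_norm _).trans_eq (integral_congr_ae
      (Eventually.of_forall (hnorm ξ)))
  have hterm (j : ℕ) : Integrable (fun ξ : Ed d =>
      exp (I * ((⟪x, ξ⟫ - t * ‖ξ‖ ^ (2 * s) : ℝ) : ℂ)) * (scaleAmp d β (2 ^ j / 2) ξ : ℂ) *
        F ξ) := by
    refine Integrable.mul_bdd (c := ∫ y, ‖u y‖) ?_ hFm.aestronglyMeasurable (Eventually.of_forall hFb)
    refine (integrable_scaleAmp β (hNpos j)).ofReal.bdd_mul (c := 1) ?_ ?_
    · refine Measurable.aestronglyMeasurable ?_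
      fun_prop
    · refine Eventually.of_forall fun p => ?_
      rw [mul_comm, norm_exp_ofReal_mul_I]
  simp only [hsum]
  rw [integral_finsetSum _ fun j _ => hterm j]
  simp only [hF, (integral_mul_fourier_eq s β t (hNpos _) x hu).2]
  rw [← integral_finsetSum _ fun j _ => (integral_mul_fourier_eq s β t (hNpos j) x hu).1,
    ← integral_const_mul]
  refine norm_integral_le_of_norm_le (hu.norm.const_mul _) (Eventually.of_forall fun y => ?_)
  rw [← Finset.sum_mul, norm_mul]
  gcongr
  exact (norm_sum_le _ _).trans (h t (x - y) J ht)

end Assembly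

theorem stmt7 (d : ℕ) (hd : 2 ≤ d) (s : ℝ) (hs : 0 < s) (hs' : s ≠ 1/2)
    (β : ℝ) (hβ : -(d : ℝ) < β) (hβs : ((d : ℝ) + β) / (2 * s) ≤ (d : ℝ) / 2)
    (θ : ℝ) (hθ1 : ((d : ℝ) + β) / (2 * s) ≤ θ) (hθ2 : θ ≤ (d : ℝ) / 2) :
    ∃ C : ℝ, 0 < C ∧ ∀ (t : ℝ), t ≠ 0 → ∀ u₀ : SchwartzMap (Ed d) ℂ,
      (∀ ξ : Ed d, FT (⇑u₀) ξ ≠ 0 → 1/2 ≤ ‖ξ‖) →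
      eLpNorm (fracDProp β s t (⇑u₀)) ⊤ volume
        ≤ ENNReal.ofReal (C * |t| ^ (-θ)) * eLpNorm (⇑u₀) 1 volume := by
  have hs2 : 0 < 2 * s := by positivity
  have hθ : 0 < θ := lt_of_lt_of_le (div_pos (by linarith) hs2) hθ1
  have hβθ : (d : ℝ) + β ≤ 2 * s * θ := by rwa [div_le_iff₀ hs2, mul_comm θ] at hθ1
  obtain ⟨C, hC, h⟩ := exists_norm_integral_le (by omega) hs hs' hθ hθ2 hβθ
  have hP : 0 < (2 * Real.pi) ^ (-(d : ℝ)) := by positivity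
  refine ⟨(2 * Real.pi) ^ (-(d : ℝ)) * (C + 1), by positivity, fun t ht u₀ hsupp => ?_⟩
  have hbound (x : Ed d) : ‖fracDProp β s t u₀ x‖ ≤
      (2 * Real.pi) ^ (-(d : ℝ)) * (C + 1) * |t| ^ (-θ) * ∫ y, ‖u₀ y‖ := by
    have hx := h t ht x u₀ u₀.integrable hsupp
    have heq : fracDProp β s t u₀ x = (((2 * Real.pi) ^ (-(d : ℝ)) : ℝ) : ℂ) *
        ∫ ξ : Ed d, exp (I * ((⟪x, ξ⟫ - t * ‖ξ‖ ^ (2 * s) : ℝ) : ℂ)) * ((‖ξ‖ ^ β : ℝ) : ℂ) *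
          (∫ y : Ed d, exp (-I * ((⟪y, ξ⟫ : ℝ) : ℂ)) * u₀ y) := by
      rw [fracDProp, FTinv]
      congr 1
      refine integral_congr_ae (Filter.Eventually.of_forall fun ξ => ?_)
      have hexp : exp (I * ((⟪x, ξ⟫ - t * ‖ξ‖ ^ (2 * s) : ℝ) : ℂ)) =
          exp (I * ((⟪x, ξ⟫ : ℝ) : ℂ)) * exp (-I * (t : ℂ) * ((‖ξ‖ ^ (2 * s) : ℝ) : ℂ)) := by
        rw [← exp_add]
        congr 1
        push_cast
        ring
      simp only [hexp, FT]
      ring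
    have hI : 0 ≤ ∫ y, ‖u₀ y‖ := integral_nonneg fun y => norm_nonneg (u₀ y)
    rw [heq, norm_mul, norm_real, Real.norm_of_nonneg hP.le, mul_assoc, mul_assoc]
    refine mul_le_mul_of_nonneg_left (hx.trans ?_) hP.le
    rw [mul_assoc]
    gcongr
    linarith
  rw [eLpNorm_exponent_top, eLpNorm_one_eq_lintegral_enorm,
    ← ofReal_integral_norm_eq_lintegral_enorm u₀.integrable,
    ← ENNReal.ofReal_mul (by positivity)]
  exact eLpNormEssSup_le_of_ae_bound (Filter.Eventually.of_forall hbound)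

end
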